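/- arXiv:2010.06872 — 3 statements merged into one kernel-verified Lean document; each statement's English description precedes it below -/
import Mathlib

section
/- For a Hopf algebra H with bijective antipode, exp₀(H^op) = exp₀(H^cop) = exp₀(H), where H^op has opposite multiplication and H^cop has opposite comultiplication. -/
open TensorProduct

noncomputable section

variable (k H : Type*) [CommRing k] [Ring H] [Bialgebra k H]

/-- Convolution product `f * g = m ∘ (f ⊗ g) ∘ Δ` on linear endomorphisms. -/
def conv (f g : Module.End k H) : Module.End k H :=
  LinearMap.mul' k H ∘ₗ TensorProduct.map f g ∘ₗ Coalgebra.comul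

/-- The convolution unit `u ∘ ε`. -/
def convOne : Module.End k H := (Algebra.linearMap k H) ∘ₗ Coalgebra.counit

/-- `convSeq F n = m_n ∘ (F 0 ⊗ F 1 ⊗ ⋯ ⊗ F (n-1)) ∘ Δ_n` (as an iterated convolution). -/
def convSeq : (ℕ → Module.End k H) → ℕ → Module.End k H
  | _, 0 => convOne k H
  | F, n + 1 => conv k H (F 0) (convSeq (fun j => F (j + 1)) n)

/-- The `n`-th Sweedler power `[n] = m_n ∘ Δ_n` as a linear endomorphism. -/
def sweedlerPow (n : ℕ) : Module.End k H := convSeq k H (fun _ => LinearMap.id) n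

/-- The twisted Sweedler power `m_n ∘ (id ⊗ T ⊗ T² ⊗ ⋯ ⊗ T^(n-1)) ∘ Δ_n`. -/
def twistPow (T : Module.End k H) (n : ℕ) : Module.End k H :=
  convSeq k H (fun j => T ^ j) n

/-- `exp₀(H)`: the least `n ≥ 1` with `[n] = u ∘ ε`, in `ℕ ∪ {∞}` (`sInf ∅ = ∞`). -/
def exp0 : ℕ∞ :=
  sInf {e : ℕ∞ | ∃ n : ℕ, e = n ∧ 0 < n ∧ sweedlerPow k H n = convOne k H}

/-- The `T`-twisted exponent: least `n ≥ 1` with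
`m_n ∘ (id ⊗ T ⊗ ⋯ ⊗ T^(n-1)) ∘ Δ_n = u ∘ ε`, in `ℕ ∪ {∞}`.  For `T = S⁻²` this is
`exp(H)` and for `T = S^(2i)` this is the twisted exponent `exp_{2i}(H)`. -/
def expAt (T : Module.End k H) : ℕ∞ :=
  sInf {e : ℕ∞ | ∃ n : ℕ, e = n ∧ 0 < n ∧ twistPow k H T n = convOne k H}

open WithConv in
lemma sweedlerPow_eq (k H : Type*) [CommRing k] [Ring H] [Bialgebra k H] (n : ℕ) :
    sweedlerPow k H n = ((toConv (LinearMap.id : H →ₗ[k] H)) ^ n).ofConv := by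
  induction n with
  | zero => rfl
  | succ n ih =>
    rw [pow_succ']
    have h1 : sweedlerPow k H (n + 1) = conv k H LinearMap.id (sweedlerPow k H n) := rfl
    rw [h1, ih]
    rfl

open WithConv in
lemma pow_eq_one_iff_antipode (k H : Type*) [CommRing k] [Ring H] [HopfAlgebra k H] (n : ℕ) :
    (toConv (HopfAlgebra.antipode k (A := H))) ^ n = 1 ↔
      (toConv (LinearMap.id : H →ₗ[k] H)) ^ n = 1 := by
  have h1 := LinearMap.antipode_mul_id (R := k) (C := H)
  have h2 := LinearMap.id_mul_antipode (R := k) (C := H)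
  have hc : Commute (toConv (HopfAlgebra.antipode k (A := H)))
      (toConv (LinearMap.id : H →ₗ[k] H)) := h1.trans h2.symm
  have h3 : (toConv (HopfAlgebra.antipode k (A := H))) ^ n *
      (toConv (LinearMap.id : H →ₗ[k] H)) ^ n = 1 := by
    rw [← hc.mul_pow, h1, one_pow]
  constructor <;> intro h <;> simpa [h] using h3

open WithConv in
lemma op_key (k H K : Type*) [CommRing k] [Ring H] [HopfAlgebra k H]
    [Ring K] [Bialgebra k K] (e : K ≃ₗ[k] H)
    (hmul : ∀ a b : K, e (a * b) = e b * e a)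
    (hone : e 1 = 1)
    (hcomul : ∀ a : K, TensorProduct.map e.toLinearMap e.toLinearMap (Coalgebra.comul a) =
        Coalgebra.comul (e a))
    (hcounit : ∀ a : K, Coalgebra.counit (R := k) a = Coalgebra.counit (e a)) (n : ℕ) (x : K) :
    HopfAlgebra.antipode k (e (((toConv (LinearMap.id : K →ₗ[k] K)) ^ n).ofConv x)) =
      ((toConv (HopfAlgebra.antipode k (A := H))) ^ n).ofConv (e x) := by
  induction n generalizing x with
  | zero =>
    rw [pow_zero, pow_zero, LinearMap.convOne_apply, LinearMap.convOne_apply,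
      Algebra.algebraMap_eq_smul_one, Algebra.algebraMap_eq_smul_one, map_smul, map_smul, hone,
      HopfAlgebra.antipode_one, hcounit]
  | succ n ih =>
    rw [pow_succ', pow_succ', LinearMap.convMul_apply, LinearMap.convMul_apply, ← hcomul]
    induction (Coalgebra.comul (R := k) x) with
    | zero => simp
    | add a b ha hb => simp only [map_add, ha, hb]
    | tmul a b =>
      simp [hmul, HopfAlgebra.antipode_mul_antidistrib, ih]

open WithConv in
lemma cop_key (k H K : Type*) [CommRing k] [Ring H] [HopfAlgebra k H]
    [Ring K] [Bialgebra k K] (e : K ≃ₗ[k] H)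
    (hmul : ∀ a b : K, e (a * b) = e a * e b)
    (hone : e 1 = 1)
    (hcomul : ∀ a : K, TensorProduct.map e.toLinearMap e.toLinearMap (Coalgebra.comul a) =
        TensorProduct.comm k H H (Coalgebra.comul (e a)))
    (hcounit : ∀ a : K, Coalgebra.counit (R := k) a = Coalgebra.counit (e a)) (n : ℕ) (x : K) :
    HopfAlgebra.antipode k (e (((toConv (LinearMap.id : K →ₗ[k] K)) ^ n).ofConv x)) =
      ((toConv (HopfAlgebra.antipode k (A := H))) ^ n).ofConv (e x) := by
  induction n generalizing x with
  | zero =>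
    rw [pow_zero, pow_zero, LinearMap.convOne_apply, LinearMap.convOne_apply,
      Algebra.algebraMap_eq_smul_one, Algebra.algebraMap_eq_smul_one, map_smul, map_smul, hone,
      HopfAlgebra.antipode_one, hcounit]
  | succ n ih =>
    have hc : Coalgebra.comul (R := k) (e x) = TensorProduct.comm k H H
        (TensorProduct.map e.toLinearMap e.toLinearMap (Coalgebra.comul x)) := by
      rw [hcomul]
      exact ((TensorProduct.comm k H H).symm_apply_apply _).symm
    rw [pow_succ, pow_succ', LinearMap.convMul_apply, LinearMap.convMul_apply, hc]
    induction (Coalgebra.comul (R := k) x) with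
    | zero => simp
    | add a b ha hb => simp only [map_add, ha, hb]
    | tmul a b =>
      simp [hmul, HopfAlgebra.antipode_mul_antidistrib, ih]

open WithConv in
lemma exp0_eq_of_key (k H K : Type*) [CommRing k] [Ring H] [HopfAlgebra k H]
    [Ring K] [Bialgebra k K] (e : K ≃ₗ[k] H)
    (hS : Function.Injective (HopfAlgebra.antipode k (A := H)))
    (key : ∀ (n : ℕ) (x : K),
      HopfAlgebra.antipode k (e (((toConv (LinearMap.id : K →ₗ[k] K)) ^ n).ofConv x)) =
        ((toConv (HopfAlgebra.antipode k (A := H))) ^ n).ofConv (e x)) :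
    exp0 k K = exp0 k H := by
  have h : ∀ n, sweedlerPow k K n = convOne k K ↔ sweedlerPow k H n = convOne k H := by
    intro n
    have hK : sweedlerPow k K n = convOne k K ↔ (toConv (LinearMap.id : K →ₗ[k] K)) ^ n = 1 := by
      rw [sweedlerPow_eq]
      exact ⟨fun h => WithConv.ext h, fun h => congrArg ofConv h⟩
    have hH : sweedlerPow k H n = convOne k H ↔ (toConv (LinearMap.id : H →ₗ[k] H)) ^ n = 1 := by
      rw [sweedlerPow_eq]
      exact ⟨fun h => WithConv.ext h, fun h => congrArg ofConv h⟩
    rw [hK, hH, ← pow_eq_one_iff_antipode]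
    have key0 := key 0
    rw [pow_zero, pow_zero] at key0
    constructor
    · intro h
      refine WithConv.ext (LinearMap.ext fun y => ?_)
      obtain ⟨x, rfl⟩ := e.surjective y
      rw [← key, h, key0]
    · intro h
      refine WithConv.ext (LinearMap.ext fun x => ?_)
      apply e.injective
      apply hS
      rw [key, h, key0]
  unfold exp0
  simp only [h]

/-- for a Hopf algebra `H` with bijective antipode,
`exp₀(H^op) = exp₀(H^cop) = exp₀(H)`.  Here `Hop` (resp. `Hcop`) is a Hopf algebra
identified with `H` as a coalgebra (resp. algebra) but with the opposite multiplication
(resp. opposite comultiplication). -/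
theorem stmt7 (k H Hop Hcop : Type*) [Field k] [Ring H] [HopfAlgebra k H]
    [Ring Hop] [HopfAlgebra k Hop] [Ring Hcop] [HopfAlgebra k Hcop]
    -- the antipode of `H` is bijective:
    (Sinv : Module.End k H)
    (hS1 : Sinv ∘ₗ HopfAlgebra.antipode (R := k) (A := H) = LinearMap.id)
    (hS2 : HopfAlgebra.antipode (R := k) (A := H) ∘ₗ Sinv = LinearMap.id)
    -- `Hop` is `H` with the opposite multiplication:
    (eop : Hop ≃ₗ[k] H)
    (hop_mul : ∀ a b : Hop, eop (a * b) = eop b * eop a)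
    (hop_one : eop 1 = 1)
    (hop_comul : ∀ a : Hop,
      TensorProduct.map eop.toLinearMap eop.toLinearMap (Coalgebra.comul a) =
        Coalgebra.comul (eop a))
    (hop_counit : ∀ a : Hop, Coalgebra.counit (R := k) a = Coalgebra.counit (eop a))
    -- `Hcop` is `H` with the opposite comultiplication:
    (ecop : Hcop ≃ₗ[k] H)
    (hcop_mul : ∀ a b : Hcop, ecop (a * b) = ecop a * ecop b)
    (hcop_one : ecop 1 = 1)
    (hcop_comul : ∀ a : Hcop,
      TensorProduct.map ecop.toLinearMap ecop.toLinearMap (Coalgebra.comul a) =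
        TensorProduct.comm k H H (Coalgebra.comul (ecop a)))
    (hcop_counit : ∀ a : Hcop, Coalgebra.counit (R := k) a = Coalgebra.counit (ecop a)) :
    exp0 k Hop = exp0 k H ∧ exp0 k Hcop = exp0 k H := by
  have hS : Function.Injective (HopfAlgebra.antipode k (A := H)) := fun a b hab => by
    have ha := LinearMap.congr_fun hS1 a
    have hb := LinearMap.congr_fun hS1 b
    simp only [LinearMap.comp_apply, LinearMap.id_apply] at ha hb
    rw [← ha, ← hb, hab]
  exact ⟨exp0_eq_of_key k H Hop eop hS (op_key k H Hop eop hop_mul hop_one hop_comul hop_counit),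
    exp0_eq_of_key k H Hcop ecop hS
      (cop_key k H Hcop ecop hcop_mul hcop_one hcop_comul hcop_counit)⟩
end
end

section
/- Let H be a finite-dimensional Hopf algebra and H ⋊ k⟨S²⟩ its pivotal semidirect product with the finite cyclic group generated by S². Then exp(H ⋊ k⟨S²⟩) = lcm over i ∈ ℤ of exp_{2i}(H), where exp_{2i}(H) := min{ n ≥ 1 : m_n ∘ (id ⊗ S^{2i} ⊗ ⋯ ⊗ S^{2(n-1)i}) ∘ Δ_n = u∘ε }. -/
open TensorProduct

noncomputable section

variable (k H : Type*) [CommRing k] [Ring H] [Bialgebra k H]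

/-- Integer powers `T^i` of an invertible endomorphism `T` with chosen inverse `Tinv`
(used for the even powers `S^{2i}`, `i ∈ ℤ`, of the antipode). -/
def zpowE (T Tinv : Module.End k H) : ℤ → Module.End k H
  | Int.ofNat n => T ^ n
  | Int.negSucc n => Tinv ^ (n + 1)

/-- `IsPivotalSmash k H P d Sinv e` says that `P` is (via the linear isomorphism
`e : P ≃ₗ H ⊗ k[ℤ/d]`, where `d` is the order of `S²` and `Sinv = S⁻¹`) the pivotal
semidirect (smash) product `H ⋊ k⟨S²⟩`: the coalgebra is the tensor product coalgebra of
`H` with the group algebra of `⟨S²⟩ ≅ ℤ/d` (whose basis vectors are grouplike), the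
multiplication is `(h ⋊ S^{2i})(h' ⋊ S^{2j}) = h S^{2i}(h') ⋊ S^{2(i+j)}`, the unit is
`1 ⋊ id`, and the antipode is `h ⋊ S^{2i} ↦ S^{-2i+1}(h) ⋊ S^{-2i}`. -/
structure IsPivotalSmash (k H P : Type*) [CommRing k] [Ring H] [HopfAlgebra k H]
    [Ring P] [HopfAlgebra k P] (d : ℕ) (Sinv : Module.End k H)
    (e : P ≃ₗ[k] H ⊗[k] (ZMod d →₀ k)) : Prop where
  d_pos : 0 < d
  order_eq : orderOf
    (((HopfAlgebra.antipode (R := k) (A := H)) ∘ₗ HopfAlgebra.antipode (R := k)) :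
      Module.End k H) = d
  Sinv_left : Sinv ∘ₗ HopfAlgebra.antipode (R := k) (A := H) = LinearMap.id
  Sinv_right : HopfAlgebra.antipode (R := k) (A := H) ∘ₗ Sinv = LinearMap.id
  mul_def : ∀ (h h' : H) (i j : ZMod d),
    e.symm (h ⊗ₜ[k] Finsupp.single i 1) * e.symm (h' ⊗ₜ[k] Finsupp.single j 1) =
      e.symm ((h * ((((HopfAlgebra.antipode (R := k) (A := H)) ∘ₗ
          HopfAlgebra.antipode (R := k)) ^ i.val : Module.End k H) h'))
        ⊗ₜ[k] Finsupp.single (i + j) 1)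
  one_def : (1 : P) = e.symm (1 ⊗ₜ[k] Finsupp.single 0 1)
  comul_def : ∀ (h : H) (i : ZMod d),
    TensorProduct.map e.toLinearMap e.toLinearMap
        (Coalgebra.comul (R := k) (e.symm (h ⊗ₜ[k] Finsupp.single i 1))) =
      TensorProduct.map ((TensorProduct.mk k H (ZMod d →₀ k)).flip (Finsupp.single i 1))
        ((TensorProduct.mk k H (ZMod d →₀ k)).flip (Finsupp.single i 1))
        (Coalgebra.comul (R := k) h)
  counit_def : ∀ (h : H) (i : ZMod d),
    Coalgebra.counit (R := k) (e.symm (h ⊗ₜ[k] Finsupp.single i 1)) =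
      Coalgebra.counit (R := k) h
  antipode_def : ∀ (h : H) (i : ZMod d),
    HopfAlgebra.antipode (R := k) (e.symm (h ⊗ₜ[k] Finsupp.single i 1)) =
      e.symm ((HopfAlgebra.antipode (R := k) (((Sinv ∘ₗ Sinv) ^ i.val : Module.End k H) h))
        ⊗ₜ[k] Finsupp.single (-i) 1)

theorem aux_ne_zero (p : ℕ → Prop) :
    sInf {e : ℕ∞ | ∃ n : ℕ, e = n ∧ 0 < n ∧ p n} ≠ 0 := by
  intro h
  have h1 : (1 : ℕ∞) ≤ sInf {e : ℕ∞ | ∃ n : ℕ, e = n ∧ 0 < n ∧ p n} := by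
    refine le_sInf ?_
    rintro _ ⟨n, rfl, hn, -⟩
    exact_mod_cast hn
  rw [h] at h1
  simp at h1

theorem aux_dvd_top (a : ℕ∞) (ha : a ≠ 0) : a ∣ ⊤ := ⟨⊤, by rw [ENat.mul_top ha]⟩

theorem aux_dvd_iff (p : ℕ → Prop) (h0 : p 0) (hadd : ∀ a b, p a → (p (a + b) ↔ p b))
    (n : ℕ) (hn : 0 < n) :
    sInf {e : ℕ∞ | ∃ n : ℕ, e = n ∧ 0 < n ∧ p n} ∣ (n : ℕ∞) ↔ p n := by
  classical
  have hmul : ∀ a c, p a → p (a * c) := by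
    intro a c ha
    induction c with
    | zero => simpa using h0
    | succ c ih =>
      rw [Nat.mul_succ, Nat.add_comm]
      exact (hadd a _ ha).2 ih
  have hmod : ∀ a c b, p a → (p (a * c + b) ↔ p b) := fun a c b ha => hadd _ b (hmul a c ha)
  by_cases hex : ∃ m, 0 < m ∧ p m
  · have hE : sInf {e : ℕ∞ | ∃ n : ℕ, e = n ∧ 0 < n ∧ p n} = ((Nat.find hex : ℕ) : ℕ∞) := by
      apply le_antisymm
      · exact sInf_le ⟨_, rfl, Nat.find_spec hex⟩
      · refine le_sInf ?_
        rintro _ ⟨m, rfl, hm⟩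
        exact_mod_cast Nat.find_min' hex hm
    have hs := Nat.find_spec hex
    have hmin : ∀ m, 0 < m ∧ p m → Nat.find hex ≤ m := fun m hm => Nat.find_min' hex hm
    rw [hE]
    generalize Nat.find hex = a at hs hmin
    constructor
    · rintro ⟨c, hc⟩
      cases c with
      | top =>
        rw [ENat.mul_top (by exact_mod_cast hs.1.ne')] at hc
        exact absurd hc (ENat.natCast_ne_top n)
      | coe c =>
        have : n = a * c := by exact_mod_cast hc
        rw [this]; exact hmul a c hs.2
    · intro hp
      have h1 : p (n % a) := by
        rw [← Nat.div_add_mod n a] at hp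
        exact (hmod _ _ _ hs.2).1 hp
      have h2 : n % a = 0 := by
        by_contra hne
        have := hmin _ ⟨Nat.pos_of_ne_zero hne, h1⟩
        have := Nat.mod_lt n hs.1
        omega
      obtain ⟨c, hc⟩ := Nat.dvd_of_mod_eq_zero h2
      exact ⟨c, by rw [hc]; push_cast; rfl⟩
  · have hE : {e : ℕ∞ | ∃ n : ℕ, e = n ∧ 0 < n ∧ p n} = ∅ := by
      ext e
      simp only [Set.mem_ofPred_eq, Set.mem_empty_iff_false, iff_false]
      rintro ⟨m, -, hm⟩
      exact hex ⟨m, hm⟩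
    rw [hE, sInf_empty]
    constructor
    · rintro ⟨c, hc⟩
      rcases eq_or_ne c 0 with rfl | hc0
      · rw [mul_zero] at hc
        exact absurd hc (by exact_mod_cast hn.ne')
      · rw [ENat.top_mul hc0] at hc
        exact absurd hc (ENat.natCast_ne_top n)
    · intro hp
      exact absurd ⟨n, hn, hp⟩ hex

section ConvLemmas

variable {K A : Type*} [CommRing K] [Ring A] [Bialgebra K A]

theorem conv_eq (f g : Module.End K A) :
    conv K A f g = (WithConv.toConv f * WithConv.toConv g).ofConv := rfl

theorem convOne_eq : convOne K A = (1 : WithConv (A →ₗ[K] A)).ofConv := rfl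

theorem conv_assoc' (f g h : Module.End K A) :
    conv K A (conv K A f g) h = conv K A f (conv K A g h) := by
  simp only [conv_eq, WithConv.toConv_ofConv, mul_assoc]

theorem one_conv' (f : Module.End K A) : conv K A (convOne K A) f = f := by
  simp only [conv_eq, convOne_eq, WithConv.toConv_ofConv, one_mul]

theorem conv_one' (f : Module.End K A) : conv K A f (convOne K A) = f := by
  simp only [conv_eq, convOne_eq, WithConv.toConv_ofConv, mul_one]

theorem convSeq_add (n m : ℕ) (F : ℕ → Module.End K A) :
    convSeq K A F (n + m) = conv K A (convSeq K A F n) (convSeq K A (fun j => F (j + n)) m) := by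
  induction n generalizing F with
  | zero => simp only [Nat.zero_add, convSeq, one_conv', Nat.add_zero]
  | succ n ih =>
    rw [Nat.add_right_comm]
    simp only [convSeq]
    rw [ih, conv_assoc']
    simp only [Nat.add_assoc, Nat.add_comm, Nat.add_left_comm]

/-- `T` is multiplicative and unital. -/
def IsMulE (T : Module.End K A) : Prop := T 1 = 1 ∧ ∀ x y, T (x * y) = T x * T y

theorem IsMulE.one : IsMulE (1 : Module.End K A) := ⟨rfl, fun _ _ => rfl⟩

theorem IsMulE.mul {T U : Module.End K A} (hT : IsMulE T) (hU : IsMulE U) : IsMulE (T * U) :=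
  ⟨by simp [hU.1, hT.1], fun x y => by simp [hU.2, hT.2]⟩

theorem IsMulE.pow {T : Module.End K A} (hT : IsMulE T) (n : ℕ) : IsMulE (T ^ n) := by
  induction n with
  | zero => exact IsMulE.one
  | succ n ih => rw [pow_succ]; exact ih.mul hT

theorem comp_conv {T : Module.End K A} (hT : IsMulE T) (f g : Module.End K A) :
    T * conv K A f g = conv K A (T * f) (T * g) := by
  have key : T ∘ₗ LinearMap.mul' K A = LinearMap.mul' K A ∘ₗ TensorProduct.map T T := by
    ext x y
    simp [hT.2]
  ext a
  have := LinearMap.congr_fun key (TensorProduct.map f g (Coalgebra.comul a))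
  simp only [conv, Module.End.mul_apply, LinearMap.comp_apply] at this ⊢
  rw [this, ← LinearMap.comp_apply (TensorProduct.map T T), ← TensorProduct.map_comp]
  rfl

theorem comp_convOne {T : Module.End K A} (hT : IsMulE T) : T * convOne K A = convOne K A := by
  ext a
  simp [convOne, Algebra.algebraMap_eq_smul_one, hT.1]

theorem comp_convSeq {T : Module.End K A} (hT : IsMulE T) (n : ℕ) (F : ℕ → Module.End K A) :
    T * convSeq K A F n = convSeq K A (fun j => T * F j) n := by
  induction n generalizing F with
  | zero => exact comp_convOne hT
  | succ n ih => simp only [convSeq]; rw [comp_conv hT, ih]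

theorem twistPow_add {T : Module.End K A} (hT : IsMulE T) (n m : ℕ) :
    twistPow K A T (n + m) = conv K A (twistPow K A T n) (T ^ n * twistPow K A T m) := by
  unfold twistPow
  rw [convSeq_add, comp_convSeq (hT.pow n)]
  simp only [← pow_add, Nat.add_comm]

theorem twistPow_one (T : Module.End K A) : twistPow K A T 1 = 1 := by
  simp only [twistPow, convSeq, conv_one', pow_zero]

theorem pow_of_twistPow {T : Module.End K A} (hT : IsMulE T) (n : ℕ)
    (h : twistPow K A T n = convOne K A) : T ^ n = 1 := by
  have h1 := twistPow_add hT n 1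
  rw [Nat.add_comm, twistPow_add hT 1 n, h, comp_convOne (hT.pow 1), conv_one', twistPow_one,
    one_conv', mul_one] at h1
  exact h1.symm

theorem twistPow_period {T : Module.End K A} (hT : IsMulE T) (a b : ℕ)
    (h : twistPow K A T a = convOne K A) :
    twistPow K A T (a + b) = convOne K A ↔ twistPow K A T b = convOne K A := by
  rw [twistPow_add hT, h, pow_of_twistPow hT a h, one_conv', one_mul]

theorem expAt_dvd_iff {T : Module.End K A} (hT : IsMulE T) (n : ℕ) (hn : 0 < n) :
    expAt K A T ∣ (n : ℕ∞) ↔ twistPow K A T n = convOne K A :=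
  aux_dvd_iff (fun n => twistPow K A T n = convOne K A) rfl (fun a b => twistPow_period hT a b) n hn

theorem convSeq_apply_one (n : ℕ) (F : ℕ → Module.End K A) (hF : ∀ j, F j 1 = 1) :
    convSeq K A F n 1 = 1 := by
  induction n generalizing F with
  | zero => simp [convSeq, convOne]
  | succ n ih =>
    simp [convSeq, conv, Algebra.TensorProduct.one_def, hF, ih (fun j => F (j + 1)) (fun j => hF _)]

theorem zpowE_eq (u : (Module.End K A)ˣ) (i : ℤ) :
    zpowE K A (u : Module.End K A) ((u⁻¹ : (Module.End K A)ˣ) : Module.End K A) i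
      = ((u ^ i : (Module.End K A)ˣ) : Module.End K A) := by
  cases i with
  | ofNat n => simp [zpowE]
  | negSucc n => simp [zpowE, zpow_negSucc, ← inv_pow]

end ConvLemmas

section Smash

variable {K A Q : Type*} [Field K] [Ring A] [HopfAlgebra K A] [Ring Q] [HopfAlgebra K Q]
  {d : ℕ} {Sinv : Module.End K A} {e : Q ≃ₗ[K] A ⊗[K] (ZMod d →₀ K)}

/-- `S²`. -/
def ssq (K A : Type*) [Field K] [Ring A] [HopfAlgebra K A] : Module.End K A :=
  (HopfAlgebra.antipode (R := K) (A := A)) ∘ₗ HopfAlgebra.antipode (R := K)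

theorem ssq_isMulE : IsMulE (ssq K A) :=
  ⟨by simp [ssq], fun x y => by simp [ssq, HopfAlgebra.antipode_mul_antidistrib]⟩

/-- the embedding `h ↦ h ⋊ g^i` -/
def iot (e : Q ≃ₗ[K] A ⊗[K] (ZMod d →₀ K)) (i : ZMod d) : A →ₗ[K] Q :=
  e.symm.toLinearMap ∘ₗ (TensorProduct.mk K A (ZMod d →₀ K)).flip (Finsupp.single i 1)

theorem iot_apply (i : ZMod d) (h : A) : iot e i h = e.symm (h ⊗ₜ[K] Finsupp.single i 1) := rfl

theorem iot_ext {M : Type*} [AddCommGroup M] [Module K M] {f g : Q →ₗ[K] M}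
    (h : ∀ i, f ∘ₗ iot e i = g ∘ₗ iot e i) : f = g := by
  have : f ∘ₗ e.symm.toLinearMap = g ∘ₗ e.symm.toLinearMap := by
    ext a i
    exact LinearMap.congr_fun (h i) a
  ext q
  have := LinearMap.congr_fun this (e q)
  simpa using this

/-- projection to the `i`-th component -/
def prj (e : Q ≃ₗ[K] A ⊗[K] (ZMod d →₀ K)) (i : ZMod d) : Q →ₗ[K] A :=
  (TensorProduct.rid K A).toLinearMap ∘ₗ
    TensorProduct.map LinearMap.id (Finsupp.lapply i) ∘ₗ e.toLinearMap

open Classical in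
theorem prj_iot (i j : ZMod d) (h : A) : prj e j (iot e i h) = if i = j then h else 0 := by
  simp [prj, iot_apply, Finsupp.single_apply]

theorem comul_iot (hs : IsPivotalSmash K A Q d Sinv e) (i : ZMod d) (h : A) :
    Coalgebra.comul (R := K) (iot e i h)
      = TensorProduct.map (iot e i) (iot e i) (Coalgebra.comul (R := K) h) := by
  have h1 := congrArg (TensorProduct.map e.symm.toLinearMap e.symm.toLinearMap) (hs.comul_def h i)
  rw [← LinearMap.comp_apply, ← LinearMap.comp_apply (TensorProduct.map e.symm.toLinearMap _)
    (TensorProduct.map _ _), ← TensorProduct.map_comp,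
    ← TensorProduct.map_comp] at h1
  simpa [iot] using h1

theorem convSeq_iot (hs : IsPivotalSmash K A Q d Sinv e) (i : ZMod d) (n : ℕ)
    (G : ℕ → Module.End K Q) (F : ℕ → Module.End K A)
    (hGF : ∀ j, G j ∘ₗ iot e i = iot e i ∘ₗ F j) :
    convSeq K Q G n ∘ₗ iot e i
      = iot e (n * i) ∘ₗ convSeq K A (fun j => (ssq K A ^ i.val) ^ j * F j) n := by
  induction n generalizing G F with
  | zero =>
    ext h
    simp only [convSeq, convOne, LinearMap.comp_apply, iot_apply, hs.counit_def]
    simp [Algebra.algebraMap_eq_smul_one, hs.one_def, ← TensorProduct.smul_tmul']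
  | succ n ih =>
    have ih' := ih (fun j => G (j + 1)) (fun j => F (j + 1)) (fun j => hGF _)
    have hT : IsMulE (ssq K A ^ i.val) := ssq_isMulE.pow _
    have hR : convSeq K A (fun j => (ssq K A ^ i.val) ^ j * F j) (n + 1)
        = conv K A (F 0) ((ssq K A ^ i.val) *
          convSeq K A (fun j => (ssq K A ^ i.val) ^ j * F (j + 1)) n) := by
      rw [comp_convSeq hT]
      simp only [convSeq, pow_succ', mul_assoc, pow_zero, one_mul]
    rw [hR]
    generalize convSeq K A (fun j => (ssq K A ^ i.val) ^ j * F (j + 1)) n = W at *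
    have hm : LinearMap.mul' K Q ∘ₗ TensorProduct.map (iot e i) (iot e (n * i))
        = iot e ((n + 1 : ℕ) * i) ∘ₗ LinearMap.mul' K A ∘ₗ
          TensorProduct.map LinearMap.id (ssq K A ^ i.val) := by
      ext x y
      have := hs.mul_def x y i (n * i)
      have hi : i + n * i = (n + 1 : ℕ) * i := by push_cast; ring
      rw [hi] at this
      exact this
    ext h
    simp only [convSeq, conv, LinearMap.comp_apply, comul_iot hs]
    have h2 : TensorProduct.map (G 0) (convSeq K Q (fun j => G (j + 1)) n) ∘ₗ
        TensorProduct.map (iot e i) (iot e i)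
        = TensorProduct.map (iot e i) (iot e (n * i)) ∘ₗ TensorProduct.map (F 0) W := by
      rw [← TensorProduct.map_comp, ← TensorProduct.map_comp, ih', hGF]
    have h3 := LinearMap.congr_fun h2 (Coalgebra.comul (R := K) h)
    simp only [LinearMap.comp_apply] at h3
    rw [h3]
    have h4 := LinearMap.congr_fun hm (TensorProduct.map (F 0) W (Coalgebra.comul (R := K) h))
    simp only [LinearMap.comp_apply] at h4
    rw [h4, ← LinearMap.comp_apply (TensorProduct.map _ _), ← TensorProduct.map_comp]
    rfl

/-- `S²` as a unit. -/
def sqU (hs : IsPivotalSmash K A Q d Sinv e) : (Module.End K A)ˣ where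
  val := ssq K A
  inv := Sinv ∘ₗ Sinv
  val_inv := by
    ext x
    have := fun y => LinearMap.congr_fun hs.Sinv_right y
    simp only [LinearMap.comp_apply, LinearMap.id_apply] at this
    simp [ssq, this]
  inv_val := by
    ext x
    have := fun y => LinearMap.congr_fun hs.Sinv_left y
    simp only [LinearMap.comp_apply, LinearMap.id_apply] at this
    simp [ssq, this]

theorem sqU_order (hs : IsPivotalSmash K A Q d Sinv e) : orderOf (sqU hs) = d := by
  exact orderOf_units.symm.trans hs.order_eq

theorem antipode_sq_iot (hs : IsPivotalSmash K A Q d Sinv e) (i : ZMod d) (h : A) :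
    HopfAlgebra.antipode (R := K) (HopfAlgebra.antipode (R := K) (iot e i h))
      = iot e i (ssq K A h) := by
  have : NeZero d := ⟨hs.d_pos.ne'⟩
  have hcomm : Commute (Sinv ∘ₗ Sinv : Module.End K A) (HopfAlgebra.antipode (R := K) (A := A)) := by
    have h1 : Commute (Sinv : Module.End K A) (HopfAlgebra.antipode (R := K) (A := A)) := by
      have := hs.Sinv_left.trans hs.Sinv_right.symm
      exact this
    exact h1.mul_left h1
  have hp : (Sinv ∘ₗ Sinv : Module.End K A) ^ (-i).val * (Sinv ∘ₗ Sinv) ^ i.val = 1 := by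
    rw [← pow_add]
    have hd : d ∣ (-i).val + i.val := by
      rw [← ZMod.natCast_eq_zero_iff]; simp
    obtain ⟨c, hc⟩ := hd
    rw [hc]
    have h2 : (sqU hs)⁻¹ ^ (d * c) = 1 := by
      have h5 : sqU hs ^ d = 1 := orderOf_dvd_iff_pow_eq_one.1 (dvd_of_eq (sqU_order hs))
      rw [pow_mul, inv_pow, h5]; simp
    exact congrArg Units.val h2
  simp only [iot_apply, hs.antipode_def, neg_neg]
  congr 2
  have h3 : (Sinv ∘ₗ Sinv : Module.End K A) ^ (-i).val *
      (HopfAlgebra.antipode (R := K) (A := A) * (Sinv ∘ₗ Sinv : Module.End K A) ^ i.val)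
      = HopfAlgebra.antipode (R := K) (A := A) := by
    rw [← mul_assoc, (hcomm.pow_left _).eq, mul_assoc, hp, mul_one]
  have h4 := LinearMap.congr_fun h3 h
  simp only [Module.End.mul_apply] at h4
  rw [h4]; rfl

theorem SPinv_iot (hs : IsPivotalSmash K A Q d Sinv e) (SPinv : Module.End K Q)
    (hSP1 : SPinv ∘ₗ HopfAlgebra.antipode (R := K) (A := Q) = LinearMap.id) (i : ZMod d) :
    (SPinv ∘ₗ SPinv) ∘ₗ iot e i = iot e i ∘ₗ (Sinv ∘ₗ Sinv) := by
  ext h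
  have h1 := antipode_sq_iot hs i ((Sinv ∘ₗ Sinv) h)
  have h2 : ssq K A ((Sinv ∘ₗ Sinv) h) = h := LinearMap.congr_fun (sqU hs).val_inv h
  have h3 := fun y => LinearMap.congr_fun hSP1 y
  simp only [LinearMap.comp_apply, LinearMap.id_apply] at h3
  rw [h2] at h1
  simp only [LinearMap.comp_apply] at h1 ⊢
  rw [← h1, h3, h3]

theorem twistPow_iot (hs : IsPivotalSmash K A Q d Sinv e) (SPinv : Module.End K Q)
    (hSP1 : SPinv ∘ₗ HopfAlgebra.antipode (R := K) (A := Q) = LinearMap.id) (i : ZMod d) (n : ℕ) :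
    twistPow K Q (SPinv ∘ₗ SPinv) n ∘ₗ iot e i
      = iot e (n * i) ∘ₗ
        twistPow K A ((sqU hs ^ ((i.val : ℤ) - 1) : (Module.End K A)ˣ) : Module.End K A) n := by
  have hb := SPinv_iot hs SPinv hSP1 i
  have hj : ∀ j : ℕ, ((SPinv ∘ₗ SPinv : Module.End K Q) ^ j) ∘ₗ iot e i
      = iot e i ∘ₗ ((Sinv ∘ₗ Sinv : Module.End K A) ^ j) := by
    intro j
    induction j with
    | zero => rfl
    | succ j ih =>
      rw [pow_succ, pow_succ', Module.End.mul_eq_comp, Module.End.mul_eq_comp,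
        LinearMap.comp_assoc, hb, ← LinearMap.comp_assoc, ih, LinearMap.comp_assoc]
      congr 1
      exact (pow_succ _ j).symm.trans (pow_succ' _ j)
  unfold twistPow
  rw [convSeq_iot hs i n _ _ hj]
  congr 2
  funext j
  have : ((sqU hs ^ i.val) ^ j * (sqU hs)⁻¹ ^ j : (Module.End K A)ˣ)
      = (sqU hs ^ ((i.val : ℤ) - 1)) ^ j := by
    rw [zpow_sub_one, zpow_natCast, Commute.mul_pow]
    exact ((Commute.refl (sqU hs)).inv_right).pow_left _
  exact congrArg Units.val this

theorem sqU_zpow_isMulE (hs : IsPivotalSmash K A Q d Sinv e) (i : ℤ) :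
    ∃ r : ZMod d, sqU hs ^ i = sqU hs ^ ((r.val : ℤ) - 1) := by
  have : NeZero d := ⟨hs.d_pos.ne'⟩
  refine ⟨((i + 1 : ℤ) : ZMod d), ?_⟩
  rw [zpow_eq_zpow_iff_modEq, sqU_order hs, ← ZMod.intCast_eq_intCast_iff]
  push_cast
  simp

theorem isMulE_zpow (hs : IsPivotalSmash K A Q d Sinv e) (i : ℤ) :
    IsMulE ((sqU hs ^ i : (Module.End K A)ˣ) : Module.End K A) := by
  have hd : 0 < orderOf (sqU hs) := by rw [sqU_order hs]; exact hs.d_pos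
  have h1 : sqU hs ^ i ∈ Submonoid.powers (sqU hs) := by
    have hf : IsOfFinOrder (sqU hs) := orderOf_pos_iff.1 hd
    rw [hf.mem_powers_iff_mem_zpowers]
    exact ⟨i, rfl⟩
  obtain ⟨m, hm⟩ := h1
  simp only at hm
  rw [← hm, Units.val_pow_eq_pow_val]
  exact ssq_isMulE.pow m

theorem convOne_iot (hs : IsPivotalSmash K A Q d Sinv e) (i : ZMod d) :
    convOne K Q ∘ₗ iot e i = iot e 0 ∘ₗ convOne K A := by
  have := convSeq_iot hs i 0 (fun _ => 1) (fun _ => 1) (fun _ => rfl)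
  simpa [convSeq] using this

theorem iot_injective (i : ZMod d) : Function.Injective (iot e i) := by
  intro x y h
  have := congrArg (prj e i) h
  simpa [prj_iot] using this

theorem main_iff (hs : IsPivotalSmash K A Q d Sinv e) (SPinv : Module.End K Q)
    (hSP1 : SPinv ∘ₗ HopfAlgebra.antipode (R := K) (A := Q) = LinearMap.id) (n : ℕ) :
    twistPow K Q (SPinv ∘ₗ SPinv) n = convOne K Q ↔
      ∀ i : ℤ, twistPow K A ((sqU hs ^ i : (Module.End K A)ˣ) : Module.End K A) n
        = convOne K A := by
  classical
  have : Nontrivial A := by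
    refine ⟨1, 0, fun h => ?_⟩
    have := congrArg (Coalgebra.counit (R := K)) h
    simp at this
  constructor
  · intro h i
    obtain ⟨r, hr⟩ := sqU_zpow_isMulE hs i
    rw [hr]
    have h1 := twistPow_iot hs SPinv hSP1 r n
    rw [h, convOne_iot hs] at h1
    -- evaluate at 1 to see that `n * r = 0`
    have h2 := LinearMap.congr_fun h1 1
    have h3 : twistPow K A ((sqU hs ^ ((r.val : ℤ) - 1) : (Module.End K A)ˣ) : Module.End K A) n 1
        = 1 := convSeq_apply_one n _ (fun j => ((isMulE_zpow hs _).pow j).1)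
    rw [LinearMap.comp_apply, LinearMap.comp_apply, h3] at h2
    have h4 : convOne K A 1 = 1 := by simp [convOne]
    rw [h4] at h2
    have h5 := congrArg (prj e 0) h2
    rw [prj_iot, prj_iot, if_pos rfl] at h5
    have h6 : (n : ZMod d) * r = 0 := by
      by_contra hne
      rw [if_neg hne] at h5
      exact one_ne_zero h5
    rw [h6] at h1
    ext x
    exact (iot_injective (e := e) 0 (LinearMap.congr_fun h1 x)).symm
  · intro h
    have h1 := pow_of_twistPow (isMulE_zpow hs 1) n (h 1)
    have hd : d ∣ n := by
      rw [← sqU_order hs, orderOf_dvd_iff_pow_eq_one]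
      ext1
      simpa using h1
    have hn : (n : ZMod d) = 0 := (ZMod.natCast_eq_zero_iff n d).2 hd
    apply iot_ext (e := e)
    intro i
    rw [twistPow_iot hs SPinv hSP1, h, convOne_iot hs, hn, zero_mul]

end Smash

/-- for a finite-dimensional Hopf algebra `H`,
`exp(H ⋊ k⟨S²⟩) = lcm(exp_{2i}(H) : i ∈ ℤ)` — stated as: `exp(H ⋊ k⟨S²⟩)` is a common
multiple of all twisted exponents `exp_{2i}(H)` and divides every common multiple.
Here `exp(K) = expAt k K T` with `T = S_K⁻²`, and `exp_{2i}(H) = expAt k H (S^{2i})`. -/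
theorem stmt12 (k H P : Type*) [Field k] [Ring H] [HopfAlgebra k H] [FiniteDimensional k H]
    [Ring P] [HopfAlgebra k P]
    (d : ℕ) (Sinv : Module.End k H) (e : P ≃ₗ[k] H ⊗[k] (ZMod d →₀ k))
    (hsm : IsPivotalSmash k H P d Sinv e)
    (SPinv : Module.End k P)
    (hSP1 : SPinv ∘ₗ HopfAlgebra.antipode (R := k) (A := P) = LinearMap.id)
    (hSP2 : HopfAlgebra.antipode (R := k) (A := P) ∘ₗ SPinv = LinearMap.id) :
    (∀ i : ℤ,
      expAt k H (zpowE k H ((HopfAlgebra.antipode (R := k) (A := H)) ∘ₗ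
          HopfAlgebra.antipode (R := k)) (Sinv ∘ₗ Sinv) i) ∣
        expAt k P (SPinv ∘ₗ SPinv)) ∧
    ∀ m : ℕ∞,
      (∀ i : ℤ,
        expAt k H (zpowE k H ((HopfAlgebra.antipode (R := k) (A := H)) ∘ₗ
            HopfAlgebra.antipode (R := k)) (Sinv ∘ₗ Sinv) i) ∣ m) →
      expAt k P (SPinv ∘ₗ SPinv) ∣ m := by
  have hz : ∀ i : ℤ, zpowE k H ((HopfAlgebra.antipode (R := k) (A := H)) ∘ₗ
      HopfAlgebra.antipode (R := k)) (Sinv ∘ₗ Sinv) i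
      = ((sqU hsm ^ i : (Module.End k H)ˣ) : Module.End k H) := fun i => zpowE_eq (sqU hsm) i
  simp only [hz]
  have hP : ∀ n : ℕ, 0 < n → (expAt k P (SPinv ∘ₗ SPinv) ∣ (n : ℕ∞) ↔
      twistPow k P (SPinv ∘ₗ SPinv) n = convOne k P) := by
    intro n hn
    refine aux_dvd_iff (fun n => twistPow k P (SPinv ∘ₗ SPinv) n = convOne k P) rfl ?_ n hn
    intro a b ha
    simp only [main_iff hsm SPinv hSP1] at ha ⊢
    exact forall_congr' fun i => twistPow_period (isMulE_zpow hsm i) a b (ha i)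
  have key : ∀ n : ℕ, 0 < n → (expAt k P (SPinv ∘ₗ SPinv) ∣ (n : ℕ∞) ↔
      ∀ i : ℤ, expAt k H ((sqU hsm ^ i : (Module.End k H)ˣ) : Module.End k H) ∣ (n : ℕ∞)) := by
    intro n hn
    rw [hP n hn, main_iff hsm SPinv hSP1]
    exact forall_congr' fun i => (expAt_dvd_iff (isMulE_zpow hsm i) n hn).symm
  constructor
  · intro i
    have h0 : expAt k P (SPinv ∘ₗ SPinv) ≠ 0 := aux_ne_zero _
    generalize hE : expAt k P (SPinv ∘ₗ SPinv) = E at *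
    cases E with
    | top => exact aux_dvd_top _ (aux_ne_zero _)
    | coe n =>
      have hn : 0 < n := Nat.pos_of_ne_zero (by exact_mod_cast h0)
      exact (key n hn).1 dvd_rfl i
  · intro m hm
    cases m with
    | top => exact aux_dvd_top _ (aux_ne_zero _)
    | coe n =>
      rcases Nat.eq_zero_or_pos n with rfl | hn
      · simp
      · exact (key n hn).2 hm
end
end

section
/- For any finite-dimensional Hopf algebra H, exp(H ⋊ k⟨S²⟩) = lcm(exp₀(H), exp(H)). -/
open TensorProduct

noncomputable section

variable (k H : Type*) [CommRing k] [Ring H] [Bialgebra k H]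

/-! ## Part 1: Radford's formula -/
namespace Rad
open Coalgebra HopfAlgebra WithConv
variable {k H : Type*} [Field k] [Ring H] [HopfAlgebra k H]

/-- `f(x₁) x₂`. -/
def Lf : Module.Dual k H →ₗ[k] H →ₗ[k] H :=
  LinearMap.mk₂ k (fun f x => TensorProduct.lid k H (LinearMap.rTensor H f (comul x)))
    (by intros; simp [LinearMap.rTensor_add]) (by intros; simp [LinearMap.rTensor_smul])
    (by intros; simp) (by intros; simp)

/-- `x₁ f(x₂)`. -/
def Rf : Module.Dual k H →ₗ[k] H →ₗ[k] H :=
  LinearMap.mk₂ k (fun f x => TensorProduct.rid k H (LinearMap.lTensor H f (comul x)))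
    (by intros; simp [LinearMap.lTensor_add]) (by intros; simp [LinearMap.lTensor_smul])
    (by intros; simp) (by intros; simp)

lemma Lf_repr {ι : Type*} (f : Module.Dual k H) {x : H} (r : Repr k x ι) :
    Lf f x = ∑ i ∈ r.index, f (r.left i) • r.right i := by
  simp [Lf, ← r.eq]

lemma Rf_repr {ι : Type*} (f : Module.Dual k H) {x : H} (r : Repr k x ι) :
    Rf f x = ∑ i ∈ r.index, f (r.right i) • r.left i := by
  simp [Rf, ← r.eq]

lemma Lf_counit (x : H) : Lf (counit (R := k)) x = x := by
  simp [Lf]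

lemma Rf_counit (x : H) : Rf (counit (R := k)) x = x := by
  simp [Rf]

lemma f_Lf (f g : Module.Dual k H) (x : H) : g (Lf f x) = f (Rf g x) := by
  rw [Lf_repr f (ℛ k x), Rf_repr g (ℛ k x)]
  simp [mul_comm]

/-- coassociativity -/
lemma Lf_Lf (f g : Module.Dual k H) (x : H) : Lf g (Lf f x) = Lf (g ∘ₗ Lf f) x := by
  have h := LinearMap.congr_fun (coassoc (R := k) (A := H)) x
  have h2 := congrArg (fun t => TensorProduct.lid k H (TensorProduct.map f
    ((TensorProduct.lid k H).toLinearMap ∘ₗ LinearMap.rTensor H g) t)) h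
  simp only [LinearMap.comp_apply, LinearEquiv.coe_coe] at h2
  have e1 : ∀ t : H ⊗[k] H, TensorProduct.lid k H (TensorProduct.map f
      ((TensorProduct.lid k H).toLinearMap ∘ₗ LinearMap.rTensor H g)
      (TensorProduct.assoc k H H H (LinearMap.rTensor H comul t))) =
      TensorProduct.lid k H (LinearMap.rTensor H (g ∘ₗ Lf f) t) := by
    intro t
    induction t with
    | zero => simp
    | add a b ha hb => simp only [map_add, ha, hb]
    | tmul a b =>
      rw [LinearMap.rTensor_tmul, ← (ℛ k a).eq]
      simp [TensorProduct.sum_tmul, Lf_repr f (ℛ k a), smul_smul, mul_comm]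
  have e2 : ∀ t : H ⊗[k] H, TensorProduct.lid k H (TensorProduct.map f
      ((TensorProduct.lid k H).toLinearMap ∘ₗ LinearMap.rTensor H g)
      (LinearMap.lTensor H comul t)) =
      Lf g (TensorProduct.lid k H (LinearMap.rTensor H f t)) := by
    intro t
    induction t with
    | zero => simp
    | add a b ha hb => simp only [map_add, ha, hb]
    | tmul a b => simp [Lf]
  rw [e1, e2] at h2
  exact h2.symm

/-- coassociativity -/
lemma Rf_Rf (f g : Module.Dual k H) (x : H) : Rf g (Rf f x) = Rf (f ∘ₗ Lf g) x := by
  have h := LinearMap.congr_fun (coassoc (R := k) (A := H)) x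
  have h2 := congrArg (fun t => TensorProduct.rid k H (LinearMap.lTensor H
    (LinearMap.mul' k k ∘ₗ TensorProduct.map g f) t)) h
  simp only [LinearMap.comp_apply, LinearEquiv.coe_coe] at h2
  have e1 : ∀ t : H ⊗[k] H, TensorProduct.rid k H (LinearMap.lTensor H
      (LinearMap.mul' k k ∘ₗ TensorProduct.map g f)
      (TensorProduct.assoc k H H H (LinearMap.rTensor H comul t))) =
      Rf g (TensorProduct.rid k H (LinearMap.lTensor H f t)) := by
    intro t
    induction t with
    | zero => simp
    | add a b ha hb => simp only [map_add, ha, hb]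
    | tmul a b =>
      rw [LinearMap.rTensor_tmul, ← (ℛ k a).eq]
      simp [TensorProduct.sum_tmul, Rf_repr g (ℛ k a), Finset.smul_sum, smul_smul, mul_comm]
  have e2 : ∀ t : H ⊗[k] H, TensorProduct.rid k H (LinearMap.lTensor H
      (LinearMap.mul' k k ∘ₗ TensorProduct.map g f)
      (LinearMap.lTensor H comul t)) =
      TensorProduct.rid k H (LinearMap.lTensor H (f ∘ₗ Lf g) t) := by
    intro t
    induction t with
    | zero => simp
    | add a b ha hb => simp only [map_add, ha, hb]
    | tmul a b =>
      rw [LinearMap.lTensor_tmul, ← (ℛ k b).eq]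
      simp [TensorProduct.tmul_sum, Lf_repr g (ℛ k b)]
  rw [e1, e2] at h2
  exact h2

/-- `conv_right`: if `G * id = J` then `G = J * S`. -/
lemma conv_right (G J : H →ₗ[k] H)
    (h : ∀ y, ∑ i ∈ (ℛ k y).index, G ((ℛ k y).left i) * (ℛ k y).right i = J y) (y : H) :
    G y = ∑ i ∈ (ℛ k y).index, J ((ℛ k y).left i) * antipode k ((ℛ k y).right i) := by
  have h1 : toConv G * toConv LinearMap.id = toConv J := by
    ext y; rw [(ℛ k y).convMul_apply]; simpa using! h y
  have h2 : toConv G = toConv J * toConv (antipode k) := by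
    rw [← h1, mul_assoc, LinearMap.id_mul_antipode, mul_one]
  have := congrArg (fun F => F y) h2
  simp only [(ℛ k y).convMul_apply] at this
  simpa using! this

lemma conv_left (G J : H →ₗ[k] H)
    (h : ∀ y, ∑ i ∈ (ℛ k y).index, (ℛ k y).left i * G ((ℛ k y).right i) = J y) (y : H) :
    G y = ∑ i ∈ (ℛ k y).index, antipode k ((ℛ k y).left i) * J ((ℛ k y).right i) := by
  have h1 : toConv LinearMap.id * toConv G = toConv J := by
    ext y; rw [(ℛ k y).convMul_apply]; simpa using! h y
  have h2 : toConv G = toConv (antipode k) * toConv J := by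
    rw [← h1, ← mul_assoc, LinearMap.antipode_mul_id, one_mul]
  have := congrArg (fun F => F y) h2
  simp only [(ℛ k y).convMul_apply] at this
  simpa using! this

/-- the functional `y ↦ l (x * y)` -/
def lL (l : Module.Dual k H) : H →ₗ[k] Module.Dual k H := (LinearMap.mul k H).compr₂ l
/-- the functional `x ↦ l (x * y)` -/
def lR (l : Module.Dual k H) : H →ₗ[k] Module.Dual k H := (LinearMap.mul k H).flip.compr₂ l

@[simp] lemma lL_apply (l : Module.Dual k H) (x y : H) : lL l x y = l (x * y) := rfl
@[simp] lemma lR_apply (l : Module.Dual k H) (x y : H) : lR l y x = l (x * y) := rfl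

/-- First integral identity. -/
lemma int1 (l : Module.Dual k H) (hl : ∀ x, Lf l x = l x • 1) (x y : H) :
    Lf (lR l y) x = antipode k (Lf (lL l x) y) := by
  have := conv_right ((Lf.flip x) ∘ₗ lR l) ((lL l x).smulRight 1) (by
    intro y
    have h := hl (x * y)
    rw [Lf_repr l ((ℛ k x).mul (ℛ k y))] at h
    simp only [LinearMap.comp_apply, LinearMap.flip_apply, LinearMap.smulRight_apply, lL_apply]
    rw [← h]
    simp only [Lf_repr _ (ℛ k x), Coalgebra.Repr.mul_index, Coalgebra.Repr.mul_left, Coalgebra.Repr.mul_right,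
      Finset.sum_product_right, Finset.sum_mul, lR_apply, smul_mul_assoc]) y
  simp only [LinearMap.comp_apply, LinearMap.flip_apply, LinearMap.smulRight_apply] at this
  rw [this, Lf_repr _ (ℛ k y)]
  simp

/-- Second integral identity. -/
lemma int2 (l : Module.Dual k H) (a : H) (hl : ∀ x, Rf l x = l x • a) (x y : H) :
    Rf (lL l x) y = antipode k (Rf (lR l y) x) * a := by
  have := conv_left ((Rf.flip y) ∘ₗ lL l) ((lR l y).smulRight a) (by
    intro x
    have h := hl (x * y)
    rw [Rf_repr l ((ℛ k x).mul (ℛ k y))] at h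
    simp only [LinearMap.comp_apply, LinearMap.flip_apply, LinearMap.smulRight_apply, lR_apply]
    rw [← h]
    simp only [Rf_repr _ (ℛ k y), Coalgebra.Repr.mul_index, Coalgebra.Repr.mul_left, Coalgebra.Repr.mul_right,
      Finset.sum_product, Finset.mul_sum, lL_apply, mul_smul_comm]) x
  simp only [LinearMap.comp_apply, LinearMap.flip_apply, LinearMap.smulRight_apply] at this
  rw [this, Rf_repr _ (ℛ k x)]
  simp [Finset.sum_mul]

end Rad

/-! ## Part 2: integrals -/
namespace Rad
open Coalgebra HopfAlgebra WithConv
variable {k H : Type*} [Field k] [Ring H] [HopfAlgebra k H]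

/-- `h ↦ h ⊗ 1` -/
def i1 : H →ₐ[k] H ⊗[k] H := Algebra.TensorProduct.includeLeft
/-- `h ↦ 1 ⊗ h` -/
def i2 : H →ₐ[k] H ⊗[k] H := Algebra.TensorProduct.includeRight

lemma delta_eq : (toConv i1.toLinearMap * toConv i2.toLinearMap : WithConv (H →ₗ[k] H ⊗[k] H)) =
    toConv (comul (R := k) (A := H)) := by
  ext h
  rw [(ℛ k h).convMul_apply]
  conv_rhs => rw [ofConv_toConv, ← (ℛ k h).eq]
  simp [i1, i2]

lemma alg_S_mul {A : Type*} [Ring A] [Algebra k A] (i : H →ₐ[k] A) :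
    (toConv (i.toLinearMap ∘ₗ antipode k) * toConv i.toLinearMap : WithConv (H →ₗ[k] A)) = 1 := by
  have := LinearMap.algHom_comp_convMul_distrib i (toConv (antipode k (A := H))) (toConv LinearMap.id)
  rw [LinearMap.antipode_mul_id] at this
  apply ofConv_injective
  simp only [ofConv_toConv, LinearMap.comp_id] at this
  rw [← this]
  ext x
  simp [LinearMap.convOne_apply]

lemma alg_mul_S {A : Type*} [Ring A] [Algebra k A] (i : H →ₐ[k] A) :
    (toConv i.toLinearMap * toConv (i.toLinearMap ∘ₗ antipode k) : WithConv (H →ₗ[k] A)) = 1 := by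
  have := LinearMap.algHom_comp_convMul_distrib i (toConv LinearMap.id) (toConv (antipode k (A := H)))
  rw [LinearMap.id_mul_antipode] at this
  apply ofConv_injective
  simp only [ofConv_toConv, LinearMap.comp_id] at this
  rw [← this]
  ext x
  simp [LinearMap.convOne_apply]

lemma s1_delta : (toConv (i1.toLinearMap ∘ₗ antipode k) * toConv (comul (R := k) (A := H)) :
    WithConv (H →ₗ[k] H ⊗[k] H)) = toConv i2.toLinearMap := by
  rw [← delta_eq, ← mul_assoc, alg_S_mul, one_mul]

/-- `h (f(x₁) x₂) = f(S(h₁) (h₂ x)₁) (h₂ x)₂` -/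
lemma mul_Lf (f : Module.Dual k H) (h x : H) :
    h * Lf f x = ∑ i ∈ (ℛ k h).index,
      Lf (f ∘ₗ LinearMap.mulLeft k (antipode k ((ℛ k h).left i))) ((ℛ k h).right i * x) := by
  have h1 := congrArg (fun F => F h) (s1_delta (k := k) (H := H))
  simp only [(ℛ k h).convMul_apply] at h1
  have h2 := congrArg (fun t => TensorProduct.lid k H (LinearMap.rTensor H f (t * comul x))) h1
  simp only [ofConv_toConv, i2, i1] at h2
  have e1 : ∀ t : H ⊗[k] H, TensorProduct.lid k H (LinearMap.rTensor H f ((1 ⊗ₜ[k] h) * t)) =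
      h * TensorProduct.lid k H (LinearMap.rTensor H f t) := by
    intro t
    induction t with
    | zero => simp
    | add a b ha hb => simp only [mul_add, map_add, ha, hb]
    | tmul a b => simp
  have e2 : ∀ (c : H) (t : H ⊗[k] H), TensorProduct.lid k H (LinearMap.rTensor H f ((c ⊗ₜ[k] 1) * t)) =
      TensorProduct.lid k H (LinearMap.rTensor H (f ∘ₗ LinearMap.mulLeft k c) t) := by
    intro c t
    induction t with
    | zero => simp
    | add a b ha hb => simp only [mul_add, map_add, ha, hb]
    | tmul a b => simp
  simp only [AlgHom.toLinearMap_apply, Algebra.TensorProduct.includeRight_apply, LinearMap.comp_apply,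
    Algebra.TensorProduct.includeLeft_apply, e1, Finset.sum_mul, map_sum, mul_assoc, e2] at h2
  simp only [Lf, LinearMap.mk₂_apply, Bialgebra.comul_mul]
  exact h2.symm

/-- moving an endomorphism across the canonical element -/
lemma basis_move {ι N : Type*} [Fintype ι] [AddCommGroup N] [Module k N] (b : Module.Basis ι k H)
    (Φ : Module.Dual k H →ₗ[k] H →ₗ[k] N) (M : H →ₗ[k] H) :
    ∑ i, Φ (b.coord i) (M (b i)) = ∑ i, Φ (b.coord i ∘ₗ M) (b i) := by
  have h1 : ∀ i, M (b i) = ∑ j, b.coord j (M (b i)) • b j := fun i => by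
    simpa using (b.sum_repr (M (b i))).symm
  have h2 : ∀ j, b.coord j ∘ₗ M = ∑ i, b.coord j (M (b i)) • b.coord i := fun j => by
    classical
    apply b.ext
    intro l
    simp [Finsupp.single_apply, LinearMap.sum_apply]
  have h3 : ∀ i, Φ (b.coord i) (M (b i)) = ∑ j, b.coord j (M (b i)) • Φ (b.coord i) (b j) := fun i => by
    conv_lhs => rw [h1 i]
    simp only [map_sum, map_smul]
  have h4 : ∀ j, Φ (b.coord j ∘ₗ M) (b j) = ∑ i, b.coord j (M (b i)) • Φ (b.coord i) (b j) := fun j => by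
    rw [h2 j]
    simp only [map_sum, map_smul, LinearMap.sum_apply, LinearMap.smul_apply]
  simp only [h3, h4]
  exact Finset.sum_comm

section inv
variable (T : H →ₗ[k] H) (hT1 : ∀ x, T (antipode k x) = x) (hT2 : ∀ x, antipode k (T x) = x)
include hT1 hT2

lemma T_mul (x y : H) : T (x * y) = T y * T x := by
  have : antipode k (T y * T x) = x * y := by
    rw [antipode_mul_antidistrib, hT2, hT2]
  rw [← this, hT1]

lemma T_one : T 1 = 1 := by
  rw [← antipode_one (R := k), hT1, antipode_one]

lemma sum_T (h : H) : ∑ i ∈ (ℛ k h).index, (ℛ k h).right i * T ((ℛ k h).left i) =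
    counit (R := k) h • 1 := by
  have := congrArg T (sum_mul_antipode_eq_smul (R := k) (ℛ k h))
  simpa [T_mul T hT1 hT2, hT1, T_one T hT1 hT2] using this

/-- existence of a nonzero left integral -/
lemma exists_integral [FiniteDimensional k H] :
    ∃ Λ : H, Λ ≠ 0 ∧ ∀ h : H, h * Λ = counit (R := k) h • Λ := by
  let b := Module.finBasis k H
  let K : H → H →ₗ[k] H := fun v => LinearMap.mulRight k v ∘ₗ T ∘ₗ T
  let Θ : H → H := fun v => ∑ i, Lf (b.coord i ∘ₗ K v) (b i)
  have hΘ : ∀ v h, h * Θ v = counit (R := k) h • Θ v := by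
    intro v h
    have key : ∑ l ∈ (ℛ k h).index, LinearMap.mulLeft k ((ℛ k h).right l) ∘ₗ K v ∘ₗ
        LinearMap.mulLeft k (antipode k ((ℛ k h).left l)) = counit (R := k) h • K v := by
      ext w
      have := congrArg (fun t => t * (T (T w) * v)) (sum_T T hT1 hT2 h)
      simp only [Finset.sum_mul] at this
      simp only [LinearMap.sum_apply, LinearMap.comp_apply, K, LinearMap.mulLeft_apply,
        LinearMap.mulRight_apply, LinearMap.smul_apply, T_mul T hT1 hT2, hT1]
      simpa [mul_assoc] using this
    simp only [Θ, Finset.mul_sum, mul_Lf]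
    rw [Finset.sum_comm]
    have h1 : ∀ l ∈ (ℛ k h).index, ∑ i, Lf ((b.coord i ∘ₗ K v) ∘ₗ
        LinearMap.mulLeft k (antipode k ((ℛ k h).left l))) ((ℛ k h).right l * b i) =
        ∑ i, Lf (b.coord i ∘ₗ (LinearMap.mulLeft k ((ℛ k h).right l) ∘ₗ K v ∘ₗ
        LinearMap.mulLeft k (antipode k ((ℛ k h).left l)))) (b i) := by
      intro l _
      exact basis_move b (Lf ∘ₗ LinearMap.lcomp k k (K v ∘ₗ
        LinearMap.mulLeft k (antipode k ((ℛ k h).left l)))) (LinearMap.mulLeft k ((ℛ k h).right l))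
    rw [Finset.sum_congr rfl h1, Finset.sum_comm, Finset.smul_sum]
    refine Finset.sum_congr rfl fun i _ => ?_
    rw [← LinearMap.sum_apply, ← map_sum, ← LinearMap.map_smul₂]
    congr 2
    rw [← LinearMap.comp_smul, ← key]
    ext w
    simp [LinearMap.sum_apply]
  by_contra! hcon
  have hz : ∀ v, Θ v = 0 := by
    intro v
    by_contra hv
    obtain ⟨h, hh⟩ := hcon (Θ v) hv
    exact hh (hΘ v h)
  have hw : ∀ w : H, w = 0 := by
    intro w
    have h0 : ∑ j, Lf (b.coord j ∘ₗ LinearMap.mulRight k w ∘ₗ T) (Θ (b j)) = 0 := by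
      simp [hz]
    simp only [Θ, map_sum, Lf_Lf] at h0
    rw [Finset.sum_comm] at h0
    have h1 : ∀ i, ∑ j, Lf ((b.coord j ∘ₗ LinearMap.mulRight k w ∘ₗ T) ∘ₗ
        Lf (b.coord i ∘ₗ K (b j))) (b i) = b.coord i w • b i := by
      intro i
      rw [← LinearMap.sum_apply, ← map_sum]
      have : ∑ j, ((b.coord j ∘ₗ LinearMap.mulRight k w ∘ₗ T) ∘ₗ Lf (b.coord i ∘ₗ K (b j))) =
          b.coord i w • counit (R := k) := by
        ext y
        have e := congrArg (fun t => b.coord i (T t * w)) (sum_T T hT1 hT2 y)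
        simp only [map_sum, T_mul T hT1 hT2, Finset.sum_mul, map_smul, smul_mul_assoc,
          T_one T hT1 hT2, one_mul, mul_assoc] at e
        simp only [LinearMap.sum_apply, LinearMap.comp_apply, LinearMap.smul_apply]
        simp only [Lf_repr _ (ℛ k y), map_sum, map_smul, LinearMap.mulRight_apply]
        rw [Finset.sum_comm, smul_eq_mul, mul_comm, ← smul_eq_mul, ← e]
        refine Finset.sum_congr rfl fun l _ => ?_
        conv_rhs => rw [← b.sum_repr (T ((ℛ k y).right l) * w)]
        simp only [K, Finset.mul_sum, map_sum, mul_smul_comm, map_smul, LinearMap.comp_apply,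
          LinearMap.mulRight_apply, smul_eq_mul, Module.Basis.coord_apply, mul_comm]
      rw [this]
      simp [Lf_counit]
    rw [Finset.sum_congr rfl (fun i _ => h1 i)] at h0
    simpa [b.sum_repr] using h0
  have : counit (R := k) (1 : H) = 0 := by rw [hw 1, map_zero]
  simp at this

end inv
end Rad

/-! ## Part 3: Radford's formula -/
namespace Rad
open Coalgebra HopfAlgebra WithConv
variable {k H : Type*} [Field k] [Ring H] [HopfAlgebra k H]

lemma dual_ext {x y : H} (h : ∀ f : Module.Dual k H, f x = f y) : x = y := by
  rw [← sub_eq_zero, ← Module.forall_dual_apply_eq_zero_iff k]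
  intro f
  rw [map_sub, h, sub_self]

lemma comul_basis {ι : Type*} [Fintype ι] (b : Module.Basis ι k H) (x : H) :
    comul (R := k) x = ∑ i, Rf (b.coord i) x ⊗ₜ[k] b i := by
  simp only [Rf_repr _ (ℛ k x)]
  conv_lhs => rw [← (ℛ k x).eq]
  simp only [TensorProduct.sum_tmul]
  rw [Finset.sum_comm]
  refine Finset.sum_congr rfl fun l _ => ?_
  conv_lhs => rw [← b.sum_repr ((ℛ k x).right l)]
  simp only [TensorProduct.tmul_sum, TensorProduct.tmul_smul, TensorProduct.smul_tmul',
    Module.Basis.coord_apply]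

lemma Lf_int {Λ : H} (hΛ : ∀ h : H, h * Λ = counit (R := k) h • Λ) (f : Module.Dual k H) (h : H) :
    h * Lf f Λ = Lf (f ∘ₗ LinearMap.mulLeft k (antipode k h)) Λ := by
  rw [mul_Lf]
  have hh := congrArg ((Lf.flip Λ) ∘ₗ lL f ∘ₗ antipode k) ((Rf_counit h).symm.trans
    (Rf_repr (counit (R := k)) (ℛ k h)))
  simp only [map_sum, map_smul] at hh
  refine Eq.trans ?_ hh.symm
  refine Finset.sum_congr rfl fun i _ => ?_
  rw [hΛ, map_smul]
  rfl

section inv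
variable (T : H →ₗ[k] H) (hT1 : ∀ x, T (antipode k x) = x) (hT2 : ∀ x, antipode k (T x) = x)
variable [FiniteDimensional k H]
include hT1 hT2

lemma exists_lam : ∃ l : Module.Dual k H, (∀ x, Lf l x = l x • 1) ∧
    Function.Bijective (lL l) ∧ Function.Bijective (lR l) := by
  obtain ⟨Λ, hΛ0, hΛ⟩ := exists_integral T hT1 hT2
  let ell : Module.Dual k H →ₗ[k] H := Lf.flip Λ
  have hell : ∀ f, ell f = Lf f Λ := fun f => rfl
  have hmul : ∀ h f, h * ell f = ell (f ∘ₗ LinearMap.mulLeft k (antipode k h)) :=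
    fun h f => Lf_int hΛ f h
  obtain ⟨f0, hf0⟩ : ∃ f : Module.Dual k H, f Λ ≠ 0 := by
    by_contra! hc
    exact hΛ0 ((Module.forall_dual_apply_eq_zero_iff k Λ).1 hc)
  have h1mem : (1 : H) ∈ LinearMap.range ell := by
    let b := Module.finBasis k H
    let x := ell f0
    have hx : counit (R := k) x = f0 Λ := by
      simp only [x, hell]
      rw [f_Lf, Rf_counit]
    have h1 : ∑ i, antipode k (b i) * Lf (b.coord i) x = f0 Λ • 1 := by
      rw [← hx, ← sum_antipode_mul_eq_smul (R := k) (ℛ k x)]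
      simp only [Lf_repr _ (ℛ k x), Finset.mul_sum]
      rw [Finset.sum_comm]
      refine Finset.sum_congr rfl fun l _ => ?_
      conv_rhs => rw [← b.sum_repr ((ℛ k x).left l)]
      simp only [map_sum, map_smul, Finset.sum_mul, smul_mul_assoc, mul_smul_comm,
        Module.Basis.coord_apply]
    have h2 : f0 Λ • (1 : H) ∈ LinearMap.range ell := by
      rw [← h1]
      refine Submodule.sum_mem _ fun i _ => ?_
      simp only [x, hell, Lf_Lf]
      rw [← hell, hmul]
      exact ⟨_, rfl⟩
    have := Submodule.smul_mem _ (f0 Λ)⁻¹ h2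
    rwa [smul_smul, inv_mul_cancel₀ hf0, one_smul] at this
  have hsurj : Function.Surjective ell := by
    intro h
    obtain ⟨f, hf⟩ := h1mem
    refine ⟨_, (hmul h f).symm.trans ?_⟩
    rw [hf, mul_one]
  have hinj : Function.Injective ell :=
    (LinearMap.injective_iff_surjective_of_finrank_eq_finrank (Subspace.dual_finrank_eq)).2 hsurj
  obtain ⟨l, hl⟩ := hsurj 1
  have hLl : Function.Injective (lL l) := by
    rw [injective_iff_map_eq_zero]
    intro y hy
    have h1 := hmul (T y) l
    rw [hl, mul_one, hT2] at h1
    have h2 : l ∘ₗ LinearMap.mulLeft k y = 0 := hy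
    rw [h2, map_zero] at h1
    rw [← hT2 y, h1, map_zero]
  have hLs : Function.Surjective (lL l) :=
    (LinearMap.injective_iff_surjective_of_finrank_eq_finrank (Subspace.dual_finrank_eq).symm).1 hLl
  have hRl : Function.Injective (lR l) := by
    rw [injective_iff_map_eq_zero]
    intro y hy
    rw [← Module.forall_dual_apply_eq_zero_iff k]
    intro g
    obtain ⟨x, rfl⟩ := hLs g
    exact LinearMap.congr_fun hy x
  have hRs : Function.Surjective (lR l) :=
    (LinearMap.injective_iff_surjective_of_finrank_eq_finrank (Subspace.dual_finrank_eq).symm).1 hRl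
  refine ⟨l, fun x => dual_ext (k := k) fun g => ?_, ⟨hLl, hLs⟩, ⟨hRl, hRs⟩⟩
  have h1 : ell (g ∘ₗ Lf l) = ell (g 1 • l) := by
    rw [hell, ← Lf_Lf, ← hell, hl, map_smul, hl]
    simp [Lf, Algebra.TensorProduct.one_def]
  have h2 := LinearMap.congr_fun (hinj h1) x
  simpa [mul_comm] using h2

theorem radford : ∃ (χ : H →ₐ[k] k) (a : H), IsGroupLikeElem k a ∧
    ∀ x, Lf χ.toLinearMap x = antipode k a * antipode k (antipode k (antipode k (antipode k
      (Rf χ.toLinearMap x)))) * a := by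
  obtain ⟨l, hl, hL, hR⟩ := exists_lam T hT1 hT2
  have hne : (1 : H) ≠ 0 := by
    intro h
    have : counit (R := k) (1 : H) = 0 := by rw [h, map_zero]
    simp at this
  obtain ⟨y0, hy0⟩ := hL.2 (counit (R := k))
  have hy0' : ∀ y, l (y0 * y) = counit (R := k) y := fun y => LinearMap.congr_fun hy0 y
  have hx1 : l y0 = 1 := by simpa using hy0' 1
  have huniq : ∀ l' : Module.Dual k H, (∀ x, Lf l' x = l' x • 1) → ∃ c : k, l' = c • l := by
    intro l' hl'
    obtain ⟨h, rfl⟩ := hR.2 l'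
    have h1 := int1 l hl y0 h
    rw [hl', hy0, Lf_counit] at h1
    have h2 : h = (l (y0 * h)) • 1 := by
      have h3 := congrArg T h1
      rw [hT1, map_smul, T_one T hT1 hT2, lR_apply] at h3
      exact h3.symm
    refine ⟨l (y0 * h), ?_⟩
    ext x
    rw [lR_apply]
    conv_lhs => rw [h2]
    simp
  let a := Rf l y0
  have ha0 : ∀ (f : Module.Dual k H) (x : H), f (Rf l x) = l x * f a := by
    intro f x
    obtain ⟨c, hc⟩ := huniq (l ∘ₗ Lf f) (fun x => by rw [← Lf_Lf, hl]; rfl)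
    have h1 : ∀ x, f (Rf l x) = c * l x := by
      intro x
      rw [← f_Lf]
      exact LinearMap.congr_fun hc x
    rw [h1, h1, hx1]
    ring
  have ha : ∀ x, Rf l x = l x • a := fun x => dual_ext (k := k) fun f => by rw [ha0]; simp
  have hga : IsGroupLikeElem k a := by
    constructor
    · simp only [a]
      rw [← f_Lf, Lf_counit, hx1]
    · rw [comul_basis (Module.finBasis k H)]
      have : ∀ g : Module.Dual k H, Rf g a = g a • a := by
        intro g
        have h1 : l ∘ₗ Lf g = g a • l := by
          ext x
          simp only [LinearMap.comp_apply, f_Lf, ha0]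
          simp [mul_comm]
        simp only [a]
        rw [Rf_Rf, h1, map_smul, LinearMap.smul_apply]
      simp only [this, ← TensorProduct.tmul_smul, TensorProduct.smul_tmul]
      rw [← TensorProduct.tmul_sum]
      congr 1
      exact (Module.finBasis k H).sum_repr a
  have hz : ∀ x, ∃ z, lL l x = lR l z := fun x => (hR.2 (lL l x)).imp fun _ h => h.symm
  choose ζ hζ using hz
  have hζ' : ∀ x y, l (x * y) = l (y * ζ x) := fun x y => LinearMap.congr_fun (hζ x) y
  let χ : Module.Dual k H := lR l y0
  have hχ : ∀ x, χ x = counit (R := k) (ζ x) := by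
    intro x
    rw [← hy0', ← hζ', lR_apply]
  have hmul : ∀ x y, ζ (x * y) = ζ x * ζ y := by
    intro x y
    apply hR.1
    ext w
    rw [lR_apply, lR_apply, ← hζ', mul_assoc, hζ', mul_assoc, hζ', mul_assoc]
  let χA : H →ₐ[k] k := AlgHom.ofLinearMap χ (by simp [χ, hx1])
    (fun x y => by rw [hχ, hχ, hχ, hmul, Bialgebra.counit_mul])
  refine ⟨χA, a, hga, fun x => ?_⟩
  change Lf χ x = antipode k a * antipode k (antipode k (antipode k (antipode k (Rf χ x)))) * a
  have h1 : Lf χ x = antipode k (antipode k (ζ x)) := by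
    rw [int1 l hl, hζ, int1 l hl, hy0, Lf_counit]
  have h2 : ζ x = antipode k a * antipode k (antipode k (Rf χ x)) * a := by
    have e1 := int2 l a ha y0 (ζ x)
    rw [hy0, Rf_counit, ← hζ, int2 l a ha, antipode_mul_antidistrib] at e1
    exact e1
  rw [h1, h2]
  simp only [antipode_mul_antidistrib, hga.antipode_antipode, mul_assoc]

end inv
end Rad

/-! ## Part 4: the antipode squared and the twist step -/
namespace Rad
open Coalgebra HopfAlgebra WithConv
variable {k H : Type*} [Field k] [Ring H] [HopfAlgebra k H]

lemma comul_antipode (x : H) : comul (R := k) (antipode k x) =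
    TensorProduct.map (antipode k) (antipode k) (TensorProduct.comm k H H (comul x)) := by
  have h1 : (toConv ((TensorProduct.map (antipode k) (antipode k)) ∘ₗ
      (TensorProduct.comm k H H).toLinearMap ∘ₗ comul) : WithConv (H →ₗ[k] H ⊗[k] H)) =
      toConv (i2.toLinearMap ∘ₗ antipode k) * toConv (i1.toLinearMap ∘ₗ antipode k) := by
    ext h
    rw [(ℛ k h).convMul_apply]
    simp only [ofConv_toConv, LinearMap.comp_apply]
    conv_lhs => rw [← (ℛ k h).eq]
    simp [i1, i2]
  have h2 : (toConv ((TensorProduct.map (antipode k) (antipode k)) ∘ₗ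
      (TensorProduct.comm k H H).toLinearMap ∘ₗ comul) : WithConv (H →ₗ[k] H ⊗[k] H)) *
      toConv comul = 1 := by
    rw [h1, mul_assoc, s1_delta, alg_S_mul]
  have h3 := left_inv_eq_right_inv h2 (LinearMap.comul_right_inv (R := k) (C := H))
  exact (congrArg (fun F => F x) h3).symm

/-- the square of the antipode -/
def S2 (k H : Type*) [Field k] [Ring H] [HopfAlgebra k H] : Module.End k H :=
  antipode k ∘ₗ antipode k

/-- bialgebra endomorphisms -/
structure IsBi (B : Module.End k H) : Prop where
  mul : ∀ x y, B (x * y) = B x * B y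
  one : B 1 = 1
  com : TensorProduct.map B B ∘ₗ comul = comul ∘ₗ B
  cou : counit ∘ₗ B = counit

lemma IsBi.id : IsBi (1 : Module.End k H) := by
  constructor <;> intros <;> (try rfl)
  ext x
  simp

lemma IsBi.comp {A B : Module.End k H} (hA : IsBi A) (hB : IsBi B) : IsBi (A * B) := by
  constructor
  · intro x y; simp [hB.mul, hA.mul]
  · simp [hB.one, hA.one]
  · change TensorProduct.map (A ∘ₗ B) (A ∘ₗ B) ∘ₗ comul = comul ∘ₗ (A ∘ₗ B)
    rw [TensorProduct.map_comp, LinearMap.comp_assoc, hB.com, ← LinearMap.comp_assoc, hA.com,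
      LinearMap.comp_assoc]
  · change counit ∘ₗ (A ∘ₗ B) = counit
    rw [← LinearMap.comp_assoc, hA.cou, hB.cou]

lemma IsBi.pow {A : Module.End k H} (hA : IsBi A) (n : ℕ) : IsBi (A ^ n) := by
  induction n with
  | zero => exact IsBi.id
  | succ n ih => rw [pow_succ]; exact ih.comp hA

lemma S2_isBi : IsBi (S2 k H) := by
  constructor
  · intro x y; simp [S2, antipode_mul_antidistrib]
  · simp [S2]
  · ext x
    simp only [S2, LinearMap.comp_apply, comul_antipode]
    conv_lhs => rw [← (ℛ k x).eq]
    conv_rhs => rw [← (ℛ k x).eq]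
    simp
  · ext x
    simp [S2]

/-- algebra endomorphism attached to a bialgebra endomorphism -/
def IsBi.alg {B : Module.End k H} (hB : IsBi B) : H →ₐ[k] H :=
  AlgHom.ofLinearMap B hB.one hB.mul

/-- coalgebra endomorphism attached to a bialgebra endomorphism -/
def IsBi.coalg {B : Module.End k H} (hB : IsBi B) : H →ₗc[k] H :=
  { B with counit_comp := hB.cou, map_comp_comul := hB.com }

/-- the convolution algebra -/
abbrev Cv (k H : Type*) [Field k] [Ring H] [HopfAlgebra k H] := WithConv (H →ₗ[k] H)

/-- postcomposition with an algebra map -/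
def post (φ : H →ₐ[k] H) : Cv k H →* Cv k H where
  toFun f := toConv (φ.toLinearMap ∘ₗ f.ofConv)
  map_one' := by ext x; simp [LinearMap.convOne_apply]
  map_mul' f g := by
    rw [LinearMap.algHom_comp_convMul_distrib]

/-- precomposition with a coalgebra map -/
def pre (φ : H →ₗc[k] H) : Cv k H →* Cv k H where
  toFun f := toConv (f.ofConv ∘ₗ φ.toLinearMap)
  map_one' := by
    ext x
    have := LinearMap.congr_fun φ.counit_comp x
    simp only [LinearMap.comp_apply] at this
    simp [LinearMap.convOne_apply]
  map_mul' f g := by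
    rw [LinearMap.convMul_comp_coalgHom_distrib]

lemma post_apply (φ : H →ₐ[k] H) (f : Cv k H) : post φ f = toConv (φ.toLinearMap ∘ₗ f.ofConv) := rfl
lemma pre_apply (φ : H →ₗc[k] H) (f : Cv k H) : pre φ f = toConv (f.ofConv ∘ₗ φ.toLinearMap) := rfl

lemma post_smul (φ : H →ₐ[k] H) (c : k) (f : Cv k H) : post φ (c • f) = c • post φ f := by
  ext x
  simp [post_apply]

/-- iterated products -/
def sq {M : Type*} [Monoid M] (F : ℕ → M) : ℕ → M
  | 0 => 1
  | n + 1 => sq F n * F n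

lemma sq_left {M : Type*} [Monoid M] (F : ℕ → M) (n : ℕ) :
    sq F (n + 1) = F 0 * sq (fun m => F (m + 1)) n := by
  induction n with
  | zero => simp [sq]
  | succ n ih => rw [sq, ih, sq, mul_assoc]

lemma sq_map {M N : Type*} [Monoid M] [Monoid N] (φ : M →* N) (F : ℕ → M) (n : ℕ) :
    φ (sq F n) = sq (fun m => φ (F m)) n := by
  induction n with
  | zero => simp [sq]
  | succ n ih => rw [sq, map_mul, ih, sq]

lemma sq_const {M : Type*} [Monoid M] (c : M) (n : ℕ) : sq (fun _ => c) n = c ^ n := by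
  induction n with
  | zero => simp [sq]
  | succ n ih => rw [sq, ih, pow_succ]

lemma sq_conj {M : Type*} [Monoid M] (F : ℕ → M) (z z' : M) (h : z' * z = 1) (h' : z * z' = 1)
    (n : ℕ) : sq (fun m => z ^ m * F m * z' ^ m) n = sq (fun m => F m * z) n * z' ^ n := by
  have hp : ∀ n, z' ^ n * z ^ n = 1 := by
    intro n
    induction n with
    | zero => simp
    | succ n ih => rw [pow_succ, pow_succ', mul_assoc, ← mul_assoc z', h, one_mul, ih]
  induction n with
  | zero => simp [sq]
  | succ n ih =>
    rw [sq, ih, sq, pow_succ']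
    calc _ = sq (fun m => F m * z) n * (z' ^ n * z ^ n) * F n * z' ^ n := by simp only [mul_assoc]
      _ = sq (fun m => F m * z) n * F n * (z * z') * z' ^ n := by rw [hp, h', mul_one, mul_one]
      _ = _ := by simp only [mul_assoc]

/-- the twisted product -/
def tw (T : Module.End k H) (n : ℕ) : Cv k H := sq (fun m => toConv (T ^ m)) n

end Rad

/-! ## Part 5: the twist step -/
namespace Rad
open Coalgebra HopfAlgebra WithConv
variable {k H : Type*} [Field k] [Ring H] [HopfAlgebra k H]

/-- `x ↦ χ(x) 1` -/
def XX (χ : H →ₐ[k] k) : Cv k H := toConv ((Algebra.ofId k H).comp χ).toLinearMap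
/-- `x ↦ χ(S x) 1` -/
def XI (χ : H →ₐ[k] k) : Cv k H := toConv (((Algebra.ofId k H).comp χ).toLinearMap ∘ₗ antipode k)
/-- `x ↦ ε(x) b` -/
def cc (b : H) : Cv k H := toConv ((counit (R := k)).smulRight b)

lemma XX_XI (χ : H →ₐ[k] k) : XX χ * XI χ = 1 := alg_mul_S _
lemma XI_XX (χ : H →ₐ[k] k) : XI χ * XX χ = 1 := alg_S_mul _

lemma XX_apply (χ : H →ₐ[k] k) (x : H) : (XX χ) x = χ x • 1 := by
  simp [XX, Algebra.ofId_apply, Algebra.algebraMap_eq_smul_one]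

lemma cc_apply (b x : H) : (cc (k := k) b) x = counit (R := k) x • b := rfl

lemma XX_mul_apply (χ : H →ₐ[k] k) (f : Cv k H) (x : H) : (XX χ * f) x = f (Lf χ.toLinearMap x) := by
  rw [(ℛ k x).convMul_apply, Lf_repr _ (ℛ k x)]
  simp only [XX_apply, smul_mul_assoc, one_mul]
  refine Eq.trans ?_ (map_sum f.ofConv _ _).symm
  simp only [map_smul]
  rfl

lemma mul_XX_apply (χ : H →ₐ[k] k) (f : Cv k H) (x : H) : (f * XX χ) x = f (Rf χ.toLinearMap x) := by
  rw [(ℛ k x).convMul_apply, Rf_repr _ (ℛ k x)]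
  simp only [XX_apply, mul_smul_comm, mul_one]
  refine Eq.trans ?_ (map_sum f.ofConv _ _).symm
  simp only [map_smul]
  rfl

lemma cc_mul_apply (b : H) (f : Cv k H) (x : H) : (cc b * f : Cv k H) x = b * f x := by
  rw [(ℛ k x).convMul_apply]
  simp only [cc_apply, smul_mul_assoc, ← mul_smul_comm]
  rw [← Finset.mul_sum]
  congr 1
  have := congrArg f.ofConv ((Lf_counit x).symm.trans (Lf_repr (counit (R := k)) (ℛ k x)))
  simp only [map_sum, map_smul] at this
  exact this.symm

lemma mul_cc_apply (b : H) (f : Cv k H) (x : H) : (f * cc b : Cv k H) x = f x * b := by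
  rw [(ℛ k x).convMul_apply]
  simp only [cc_apply, mul_smul_comm, ← smul_mul_assoc]
  rw [← Finset.sum_mul]
  congr 1
  have := congrArg f.ofConv ((Rf_counit x).symm.trans (Rf_repr (counit (R := k)) (ℛ k x)))
  simp only [map_sum, map_smul] at this
  exact this.symm

lemma cc_cc (b c : H) : (cc b * cc c : Cv k H) = cc (b * c) := by
  ext x
  rw [cc_mul_apply, cc_apply, cc_apply, mul_smul_comm]

lemma cc_one : (cc 1 : Cv k H) = 1 := by
  ext x
  rw [cc_apply, LinearMap.convOne_apply, Algebra.algebraMap_eq_smul_one]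

lemma cc_XX (b : H) (χ : H →ₐ[k] k) : cc b * XX χ = XX χ * cc b := by
  ext x
  rw [cc_mul_apply, mul_cc_apply, XX_apply]
  simp

/-- `Rf χ` as an algebra map -/
def WR (χ : H →ₐ[k] k) : H →ₐ[k] H :=
  ((Algebra.TensorProduct.rid k k H).toAlgHom.comp
    (Algebra.TensorProduct.map (AlgHom.id k H) χ)).comp (Bialgebra.comulAlgHom k H)

lemma WR_apply (χ : H →ₐ[k] k) (x : H) : WR χ x = Rf χ.toLinearMap x := by
  rw [Rf_repr _ (ℛ k x)]
  simp only [WR, AlgHom.comp_apply, Bialgebra.comulAlgHom_apply]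
  conv_lhs => rw [← (ℛ k x).eq]
  simp

lemma Rf_bi {B : Module.End k H} (hB : IsBi B) (f : Module.Dual k H) (x : H) :
    Rf f (B x) = B (Rf (f ∘ₗ B) x) := by
  have := LinearMap.congr_fun hB.com x
  simp only [LinearMap.comp_apply] at this
  simp only [Rf, LinearMap.mk₂_apply, ← this]
  conv_lhs => rw [← (ℛ k x).eq]
  conv_rhs => rw [← (ℛ k x).eq]
  simp

/-- right multiplication by a grouplike -/
def Ra {a : H} (ha : IsGroupLikeElem k a) : H →ₗc[k] H :=
  { LinearMap.mulRight k a with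
    counit_comp := by ext x; simp [ha.counit_eq_one]
    map_comp_comul := by
      ext x
      simp only [LinearMap.comp_apply]
      rw [LinearMap.mulRight_apply, Bialgebra.comul_mul, ha.comul_eq_tmul_self]
      conv_lhs => rw [← (ℛ k x).eq]
      conv_rhs => rw [← (ℛ k x).eq]
      simp [Finset.sum_mul] }

/-- `x ↦ ε(x) a` as a coalgebra map -/
def Ca {a : H} (ha : IsGroupLikeElem k a) : H →ₗc[k] H :=
  { (counit (R := k)).smulRight a with
    counit_comp := by ext x; simp [ha.counit_eq_one]
    map_comp_comul := by
      ext x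
      simp only [LinearMap.comp_apply, LinearMap.smulRight_apply, map_smul, ha.comul_eq_tmul_self]
      conv_lhs => rw [← (ℛ k x).eq]
      have := congrArg (counit (R := k)) ((Lf_counit x).symm.trans (Lf_repr (counit (R := k)) (ℛ k x)))
      rw [this]
      simp [Finset.sum_smul, TensorProduct.smul_tmul', TensorProduct.tmul_smul, smul_smul, mul_comm] }

section step
variable {χ : H →ₐ[k] k} {a : H} (ha : IsGroupLikeElem k a)

/-- fixing the distinguished data -/
structure IsFix (χ : H →ₐ[k] k) (a : H) (B : Module.End k H) : Prop where
  bi : IsBi B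
  fχ : ∀ x, χ (B x) = χ x
  fa : B a = a

lemma IsFix.id : IsFix χ a 1 := ⟨IsBi.id, fun _ => rfl, rfl⟩

lemma IsFix.comp {A B : Module.End k H} (hA : IsFix χ a A) (hB : IsFix χ a B) : IsFix χ a (A * B) :=
  ⟨hA.bi.comp hB.bi, fun x => by simp [hA.fχ, hB.fχ], by simp [hA.fa, hB.fa]⟩

lemma IsFix.pow {A : Module.End k H} (hA : IsFix χ a A) (n : ℕ) : IsFix χ a (A ^ n) := by
  induction n with
  | zero => exact IsFix.id
  | succ n ih => rw [pow_succ]; exact ih.comp hA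

lemma IsFix.post_XX {B : Module.End k H} (hB : IsFix χ a B) : post hB.bi.alg (XX χ) = XX χ := by
  ext x
  change B ((XX χ) x) = _
  rw [XX_apply, map_smul, hB.bi.one]

lemma IsFix.pre_XX {B : Module.End k H} (hB : IsFix χ a B) : pre hB.bi.coalg (XX χ) = XX χ := by
  ext x
  change (XX χ) (B x) = _
  rw [XX_apply, XX_apply, hB.fχ]

lemma IsFix.post_cc {B : Module.End k H} (hB : IsFix χ a B) : post hB.bi.alg (cc a) = cc a := by
  ext x
  change B ((cc a : Cv k H) x) = _
  rw [cc_apply, map_smul, hB.fa]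

lemma IsFix.pre_cc {B : Module.End k H} (hB : IsFix χ a B) : pre hB.bi.coalg (cc a) = cc a := by
  ext x
  change (cc a : Cv k H) (B x) = _
  rw [cc_apply, cc_apply]
  congr 1
  exact LinearMap.congr_fun hB.bi.cou x

lemma inv_fix {M : Type*} [Monoid M] (φ : M →* M) {z z' : M} (h1 : z * z' = 1) (h2 : z' * z = 1)
    (hz : φ z = z) : φ z' = z' := by
  refine left_inv_eq_right_inv (a := z) ?_ h1
  calc φ z' * z = φ z' * φ z := by rw [hz]
    _ = 1 := by rw [← map_mul, h2, map_one]

lemma sq_smul (c : k) (F : ℕ → Cv k H) (n : ℕ) : sq (fun m => c • F m) n = c ^ n • sq F n := by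
  induction n with
  | zero => simp [sq]
  | succ n ih => rw [sq, ih, sq, smul_mul_assoc, mul_smul_comm, smul_smul, pow_succ]

include ha in
theorem step (hrad : ∀ x, Lf χ.toLinearMap x = antipode k a * (S2 k H ^ 2) (Rf χ.toLinearMap x) * a)
    (hS : IsFix χ a (S2 k H ^ 2)) {B : Module.End k H} (hB : IsFix χ a B) (n : ℕ)
    (h : tw B n = 1) : tw (B * S2 k H ^ 2) n = 1 := by
  set Q := S2 k H ^ 2 with hQ
  set z : Cv k H := cc a * XX χ with hz
  set z' : Cv k H := XI χ * cc (antipode k a) with hz'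
  have e1 : z * z' = 1 := by
    rw [hz, hz', mul_assoc, ← mul_assoc (XX χ), XX_XI, one_mul, cc_cc, ha.mul_antipode_cancel, cc_one]
  have e2 : z' * z = 1 := by
    rw [hz, hz', mul_assoc, ← mul_assoc (cc (antipode k a) : Cv k H), cc_cc, ha.antipode_mul_cancel, cc_one,
      one_mul, XI_XX]
  have hpost : ∀ {A : Module.End k H} (hA : IsFix χ a A), post hA.bi.alg z = z := fun hA => by
    rw [hz, map_mul, hA.post_cc, hA.post_XX]
  have hpre : ∀ {A : Module.End k H} (hA : IsFix χ a A), pre hA.bi.coalg z = z := fun hA => by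
    rw [hz, map_mul, hA.pre_cc, hA.pre_XX]
  have hQz : toConv Q = z * toConv (1 : Module.End k H) * z' := by
    have h1 : toConv Q * z = z * toConv (1 : Module.End k H) := by
      rw [hz, cc_XX, ← mul_assoc]
      ext x
      rw [mul_cc_apply, mul_XX_apply, ← cc_XX, mul_assoc, cc_mul_apply, XX_mul_apply]
      change Q _ * a = a * (Lf χ.toLinearMap x)
      rw [hrad, ← mul_assoc, ← mul_assoc, ha.mul_antipode_cancel, one_mul]
    rw [← h1, mul_assoc, e1, mul_one]
  have hconj : ∀ m, toConv ((B * Q) ^ m) = z ^ m * toConv (B ^ m) * z' ^ m := by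
    intro m
    induction m with
    | zero => simp
    | succ m ih =>
      have hBQ := hB.comp hS
      have f1 : toConv ((B * Q) ^ (m + 1)) = post hBQ.bi.alg (toConv ((B * Q) ^ m)) := by
        rw [pow_succ']; rfl
      have f2 : post hBQ.bi.alg (toConv (B ^ m)) =
          post hB.bi.alg (pre (hB.pow m).bi.coalg (toConv Q)) := rfl
      have f3 : post hB.bi.alg (pre (hB.pow m).bi.coalg (toConv (1 : Module.End k H))) =
          toConv (B ^ (m + 1)) := by
        rw [pow_succ']; rfl
      rw [f1, ih, map_mul, map_mul, map_pow, map_pow, hpost hBQ,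
        inv_fix (post hBQ.bi.alg) e1 e2 (hpost hBQ), f2, hQz, map_mul, map_mul, map_mul, map_mul,
        f3, hpre (hB.pow m), inv_fix (pre (hB.pow m).bi.coalg) e1 e2 (hpre (hB.pow m)), hpost hB,
        inv_fix (post hB.bi.alg) e1 e2 (hpost hB), pow_succ z, pow_succ' z']
      simp only [mul_assoc]
  have hmain : tw (B * Q) n = sq (fun m => toConv (B ^ m) * z) n * z' ^ n := by
    rw [← sq_conj _ z z' e2 e1]
    simp only [tw, hconj]
  have hWc : post (WR χ) (cc a) = χ a • (cc a : Cv k H) := by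
    ext x
    change WR χ ((cc a : Cv k H) x) = χ a • (cc a : Cv k H) x
    rw [cc_apply, map_smul, smul_comm]
    congr 1
    rw [WR_apply, Rf, LinearMap.mk₂_apply, ha.comul_eq_tmul_self]
    simp
  have hWB : ∀ m, post (WR χ) (pre (Ra ha) (toConv (B ^ m))) = χ a • (toConv (B ^ m) * z) := by
    intro m
    have g1 : pre (Ra ha) (toConv (B ^ m)) = toConv (B ^ m) * cc a := by
      ext x
      rw [mul_cc_apply]
      change (B ^ m) (x * a) = (B ^ m) x * a
      rw [(hB.pow m).bi.mul, (hB.pow m).fa]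
    have g2 : post (WR χ) (toConv (B ^ m)) = toConv (B ^ m) * XX χ := by
      ext x
      rw [mul_XX_apply]
      change WR χ ((B ^ m) x) = (B ^ m) _
      rw [WR_apply, Rf_bi (hB.pow m).bi]
      congr 3
      ext x
      exact (hB.pow m).fχ x
    rw [g1, map_mul, g2, hWc, mul_smul_comm, hz, cc_XX, mul_assoc]
  have hA : χ a ^ n • sq (fun m => toConv (B ^ m) * z) n = 1 := by
    rw [← sq_smul]
    have := congrArg (fun f => post (WR χ) (pre (Ra ha) f)) h
    simp only [tw, sq_map, hWB, map_one] at this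
    exact this
  have hcn : (cc a : Cv k H) ^ n = 1 := by
    rw [← sq_const, ← map_one (pre (Ca ha)), ← h, tw, sq_map]
    congr 1
    funext m
    ext x
    change _ = (B ^ m) ((cc a : Cv k H) x)
    rw [cc_apply, map_smul, (hB.pow m).fa]
  have hXn : XX χ ^ n = 1 := by
    rw [← sq_const, ← map_one (post ((Algebra.ofId k H).comp χ)), ← h, tw, sq_map]
    congr 1
    funext m
    ext x
    change (XX χ) x = (XX χ) ((B ^ m) x)
    rw [XX_apply, XX_apply, (hB.pow m).fχ]
  have hzn : z ^ n = 1 := by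
    rw [hz, (show Commute (cc a : Cv k H) (XX χ) from cc_XX a χ).mul_pow, hcn, hXn, one_mul]
  have hzn' : z' ^ n = 1 := by
    have : z ^ n * z' ^ n = 1 := by
      rw [← (show Commute z z' from e1.trans e2.symm).mul_pow, e1, one_pow]
    rwa [hzn, one_mul] at this
  have hχn : χ a ^ n • (1 : Cv k H) = 1 := by
    have := congrArg (post (WR χ)) hcn
    rw [map_pow, hWc, ← sq_const, sq_smul, sq_const, hcn, map_one] at this
    exact this
  rw [hmain, hzn', mul_one, ← hA, ← one_mul (sq _ n), ← smul_mul_assoc, hχn]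
  

end step
end Rad

/-! ## Part 6: all even twists, and divisibility -/
namespace Rad
open Coalgebra HopfAlgebra WithConv
section
variable {k H : Type*} [Field k] [Ring H] [HopfAlgebra k H]

lemma toConv_convOne : toConv (convOne k H) = (1 : Cv k H) := rfl

lemma toConv_convSeq (F : ℕ → Module.End k H) (n : ℕ) :
    toConv (convSeq k H F n) = sq (fun m => (toConv (F m) : Cv k H)) n := by
  induction n generalizing F with
  | zero => rfl
  | succ n ih => rw [sq_left, ← ih]; rfl

lemma twist_iff (T : Module.End k H) (n : ℕ) : twistPow k H T n = convOne k H ↔ tw T n = 1 := by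
  rw [tw, ← toConv_convSeq, ← toConv_convOne]
  exact toConv_injective.eq_iff.symm

lemma sweedler_iff (n : ℕ) :
    sweedlerPow k H n = convOne k H ↔ tw (1 : Module.End k H) n = 1 := by
  rw [← twist_iff]
  simp only [sweedlerPow, twistPow, one_pow]
  rfl

lemma sq_add {M : Type*} [Monoid M] (F : ℕ → M) (m n : ℕ) :
    sq F (m + n) = sq F m * sq (fun j => F (m + j)) n := by
  induction n with
  | zero => simp [sq]
  | succ n ih => rw [← add_assoc, sq, ih, sq, mul_assoc]

lemma tw_pow (φ : H →ₐ[k] H) (n : ℕ) (h : tw φ.toLinearMap n = 1) :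
    (φ.toLinearMap : Module.End k H) ^ n = 1 := by
  have h1 : tw φ.toLinearMap (n + 1) = toConv ((φ.toLinearMap : Module.End k H) ^ n) := by
    have : tw φ.toLinearMap (n + 1) = tw φ.toLinearMap n * toConv (φ.toLinearMap ^ n) := rfl
    rw [this, h, one_mul]
  have h2 : tw φ.toLinearMap (n + 1) = toConv (1 : Module.End k H) := by
    have h3 : sq (fun m => (toConv ((φ.toLinearMap : Module.End k H) ^ (m + 1)) : Cv k H)) n =
        post φ (tw φ.toLinearMap n) := by
      rw [tw, sq_map]
      congr 1
      funext m
      rw [pow_succ']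
      rfl
    rw [tw, sq_left, h3, h, map_one, mul_one, pow_zero]
  exact toConv_injective (h1.symm.trans h2)

lemma tw_add (φ : H →ₐ[k] H) (m n : ℕ) (h : tw φ.toLinearMap m = 1) :
    tw φ.toLinearMap (m + n) = tw φ.toLinearMap n := by
  have h1 := tw_pow φ m h
  unfold tw at *
  rw [sq_add, h, one_mul]
  simp only [pow_add, h1, one_mul]

lemma chi_S2 (χ : H →ₐ[k] k) (x : H) : χ (S2 k H x) = χ x := by
  let ψ : H →ₐ[k] k := AlgHom.ofLinearMap (χ.toLinearMap ∘ₗ antipode k) (by simp)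
    (fun x y => by simp [antipode_mul_antidistrib, mul_comm])
  have h1 := alg_mul_S χ
  have h2 := alg_mul_S ψ
  have h3 := left_inv_eq_right_inv h1 h2
  exact (congrArg (fun F => F x) h3).symm

lemma S2_isFix {χ : H →ₐ[k] k} {a : H} (ha : IsGroupLikeElem k a) : IsFix χ a (S2 k H) :=
  ⟨S2_isBi, chi_S2 χ, by simp [S2, ha.antipode_antipode]⟩

theorem all_tw [FiniteDimensional k H] (T : H →ₗ[k] H) (hT1 : ∀ x, T (antipode k x) = x)
    (hT2 : ∀ x, antipode k (T x) = x) (d : ℕ) (hd : 0 < d) (hS : S2 k H ^ d = 1) (n : ℕ)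
    (h0 : tw (1 : Module.End k H) n = 1) (h1 : tw (S2 k H ^ (d - 1)) n = 1) (j : ℕ) :
    tw (S2 k H ^ j) n = 1 := by
  obtain ⟨χ, a, ha, hrad⟩ := radford T hT1 hT2
  have hstep : ∀ j, tw (S2 k H ^ j) n = 1 → tw (S2 k H ^ (j + 2)) n = 1 := by
    intro j hj
    rw [pow_add]
    exact step ha hrad ((S2_isFix ha).pow 2) ((S2_isFix ha).pow j) n hj
  have hstep' : ∀ i j, tw (S2 k H ^ j) n = 1 → tw (S2 k H ^ (j + 2 * i)) n = 1 := by
    intro i j hj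
    induction i with
    | zero => simpa using hj
    | succ i ih => exact hstep _ ih
  rcases Nat.even_or_odd' j with ⟨i, rfl | rfl⟩
  · simpa using hstep' i 0 (by simpa using h0)
  · have := hstep' (i + 1) _ h1
    have e : d - 1 + 2 * (i + 1) = d + (2 * i + 1) := by omega
    rwa [e, pow_add, hS, one_mul] at this

end

/-! divisibility -/

/-- exponent attached to a predicate -/
def ex (p : ℕ → Prop) : ℕ∞ := sInf {e : ℕ∞ | ∃ n : ℕ, e = n ∧ 0 < n ∧ p n}

lemma ex_cases (p : ℕ → Prop) : (ex p = ⊤ ∧ ∀ m, 0 < m → ¬ p m) ∨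
    ∃ n : ℕ, ex p = n ∧ 0 < n ∧ p n ∧ ∀ m, 0 < m → p m → n ≤ m := by
  by_cases h : ∃ n, 0 < n ∧ p n
  · right
    classical
    refine ⟨Nat.find h, ?_, (Nat.find_spec h).1, (Nat.find_spec h).2,
      fun m h1 h2 => Nat.find_min' h ⟨h1, h2⟩⟩
    apply le_antisymm
    · exact sInf_le ⟨_, rfl, Nat.find_spec h⟩
    · refine le_sInf ?_
      rintro _ ⟨m, rfl, hm⟩
      exact_mod_cast Nat.find_min' h hm
  · left
    push Not at h
    refine ⟨?_, h⟩
    rw [ex, sInf_eq_top]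
    rintro _ ⟨m, rfl, h1, h2⟩
    exact absurd h2 (h m h1)

lemma ex_dvd_top (p : ℕ → Prop) : ex p ∣ ⊤ := by
  rcases ex_cases p with ⟨h, -⟩ | ⟨n, h, hn, -⟩
  · rw [h]
  · rw [h]
    refine ⟨⊤, ?_⟩
    rw [ENat.mul_top]
    exact_mod_cast hn.ne'

lemma ex_dvd (p : ℕ → Prop) (hp : ∀ m n, p m → (p (m + n) ↔ p n)) (n : ℕ) (hn : 0 < n) :
    ex p ∣ (n : ℕ∞) ↔ p n := by
  rcases ex_cases p with ⟨h, h2⟩ | ⟨n0, h, hn0, hp0, hmin⟩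
  · rw [h]
    refine ⟨?_, fun hpn => absurd hpn (h2 n hn)⟩
    rintro ⟨c, hc⟩
    by_cases h0 : c = 0
    · rw [h0, mul_zero] at hc
      exact absurd (by exact_mod_cast hc) hn.ne'
    · rw [ENat.top_mul h0] at hc
      exact absurd hc (ENat.coe_ne_top n)
  · have hmul : ∀ q r, p (n0 * q + r) ↔ p r := by
      intro q r
      induction q with
      | zero => simp
      | succ q ih => rw [Nat.mul_succ, add_comm (n0 * q), add_assoc, hp _ _ hp0, ih]
    have hzero : p 0 := (hp n0 0 hp0).1 hp0
    rw [h]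
    constructor
    · rintro ⟨c, hc⟩
      have hc' : c ≠ ⊤ := by
        rintro rfl
        rw [ENat.mul_top (by exact_mod_cast hn0.ne')] at hc
        exact ENat.coe_ne_top n hc
      lift c to ℕ using hc'
      have hc2 : n = n0 * c := by exact_mod_cast hc
      rw [hc2]
      exact (hmul c 0).2 hzero
    · intro hpn
      have hr : p (n % n0) := by
        rw [← hmul (n / n0), Nat.div_add_mod]
        exact hpn
      have hr0 : n % n0 = 0 := by
        by_contra hne
        have := hmin _ (Nat.pos_of_ne_zero hne) hr
        exact absurd (Nat.mod_lt n hn0) (by omega)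
      obtain ⟨c, hc⟩ := Nat.dvd_of_mod_eq_zero hr0
      exact ⟨c, by exact_mod_cast hc⟩

lemma ex_lcm (p q r : ℕ → Prop) (hp : ∀ m n, p m → (p (m + n) ↔ p n))
    (hq : ∀ m n, q m → (q (m + n) ↔ q n)) (hr : ∀ n, r n ↔ p n ∧ q n) :
    ex p ∣ ex r ∧ ex q ∣ ex r ∧ ∀ m : ℕ∞, ex p ∣ m → ex q ∣ m → ex r ∣ m := by
  have hr' : ∀ m n, r m → (r (m + n) ↔ r n) := by
    intro m n h
    rw [hr] at h
    rw [hr, hr, hp _ _ h.1, hq _ _ h.2]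
  refine ⟨?_, ?_, ?_⟩
  · rcases ex_cases r with ⟨h, -⟩ | ⟨n, h, hn, hrn, -⟩
    · rw [h]; exact ex_dvd_top p
    · rw [h, ex_dvd p hp n hn]; exact ((hr n).1 hrn).1
  · rcases ex_cases r with ⟨h, -⟩ | ⟨n, h, hn, hrn, -⟩
    · rw [h]; exact ex_dvd_top q
    · rw [h, ex_dvd q hq n hn]; exact ((hr n).1 hrn).2
  · intro m h1 h2
    by_cases hm : m = ⊤
    · rw [hm]; exact ex_dvd_top r
    · lift m to ℕ using hm
      rcases Nat.eq_zero_or_pos m with rfl | hm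
      · exact_mod_cast dvd_zero (ex r)
      · rw [ex_dvd p hp m hm] at h1
        rw [ex_dvd q hq m hm] at h2
        rw [ex_dvd r hr' m hm, hr]
        exact ⟨h1, h2⟩

end Rad

/-! ## Part 7: the smash product -/
namespace Rad
open Coalgebra HopfAlgebra WithConv
section
variable {k H P : Type*} [Field k] [Ring H] [HopfAlgebra k H] [Ring P] [HopfAlgebra k P]
variable {d : ℕ} {Sinv : Module.End k H} {e : P ≃ₗ[k] H ⊗[k] (ZMod d →₀ k)}

/-- the element `h ⋊ S^{2i}` -/
def io (e : P ≃ₗ[k] H ⊗[k] (ZMod d →₀ k)) (i : ZMod d) : H →ₗ[k] P :=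
  e.symm.toLinearMap ∘ₗ (TensorProduct.mk k H (ZMod d →₀ k)).flip (Finsupp.single i 1)

lemma io_apply (i : ZMod d) (h : H) : io e i h = e.symm (h ⊗ₜ[k] Finsupp.single i 1) := rfl

lemma io_inj {i j : ZMod d} {h h' : H} (hh : io e i h = io e j h') : h = h' := by
  rw [io_apply, io_apply, e.symm.injective.eq_iff] at hh
  have := congrArg (fun t => TensorProduct.rid k H (LinearMap.lTensor H
    (Finsupp.linearCombination k (fun _ : ZMod d => (1 : k))) t)) hh
  simpa using this

lemma io_ext {F G : Module.End k P} (h : ∀ i x, F (io e i x) = G (io e i x)) : F = G := by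
  have : F ∘ₗ e.symm.toLinearMap = G ∘ₗ e.symm.toLinearMap := by
    apply TensorProduct.ext'
    intro x v
    induction v using Finsupp.induction_linear with
    | zero => simp
    | add a b ha hb => simp only [TensorProduct.tmul_add, map_add, ha, hb]
    | single i c =>
      have h1 : x ⊗ₜ[k] (Finsupp.single i c : ZMod d →₀ k) = c • (x ⊗ₜ[k] Finsupp.single i 1) := by
        rw [← TensorProduct.tmul_smul, Finsupp.smul_single, smul_eq_mul, mul_one]
      rw [h1, map_smul, map_smul]
      congr 1
      exact h i x
  ext p
  have := LinearMap.congr_fun this (e p)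
  simpa using this

variable (hsm : IsPivotalSmash k H P d Sinv e)
include hsm

lemma S2_pow_d : S2 k H ^ d = 1 := by
  rw [← hsm.order_eq]
  exact pow_orderOf_eq_one _

lemma io_mul (i j : ZMod d) (x y : H) :
    io e i x * io e j y = io e (i + j) (x * (S2 k H ^ i.val) y) := hsm.mul_def x y i j

lemma io_comul (i : ZMod d) (x : H) :
    comul (R := k) (io e i x) = TensorProduct.map (io e i) (io e i) (comul x) := by
  have := congrArg (TensorProduct.map e.symm.toLinearMap e.symm.toLinearMap) (hsm.comul_def x i)
  have h1 : ∀ t : P ⊗[k] P, TensorProduct.map e.symm.toLinearMap e.symm.toLinearMap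
      (TensorProduct.map e.toLinearMap e.toLinearMap t) = t := by
    intro t
    induction t with
    | zero => simp
    | add a b ha hb => simp only [map_add, ha, hb]
    | tmul a b => simp
  have h2 : ∀ t : H ⊗[k] H, TensorProduct.map e.symm.toLinearMap e.symm.toLinearMap
      (TensorProduct.map ((TensorProduct.mk k H (ZMod d →₀ k)).flip (Finsupp.single i 1))
        ((TensorProduct.mk k H (ZMod d →₀ k)).flip (Finsupp.single i 1)) t) =
      TensorProduct.map (io e i) (io e i) t := by
    intro t
    induction t with
    | zero => simp
    | add a b ha hb => simp only [map_add, ha, hb]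
    | tmul a b => rfl
  rw [h1, h2] at this
  exact this

lemma io_seq (i : ZMod d) (n : ℕ) : ∀ (F : ℕ → Module.End k P) (G : ℕ → Module.End k H)
    (_ : ∀ j x, F j (io e i x) = io e i (G j x)) (x : H),
    convSeq k P F n (io e i x) =
      io e (n • i) (convSeq k H (fun j => S2 k H ^ (i.val * j) * G j) n x) := by
  induction n with
  | zero =>
    intro F G _ x
    simp only [convSeq, convOne, LinearMap.comp_apply, Algebra.linearMap_apply,
      Algebra.algebraMap_eq_smul_one, map_smul, zero_smul]
    rw [io_apply, hsm.counit_def, hsm.one_def, io_apply]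
  | succ n ih =>
    intro F G hFG x
    have ih' := ih (fun j => F (j + 1)) (fun j => G (j + 1)) (fun j x => hFG (j + 1) x)
    have hpost : convSeq k H (fun j => S2 k H ^ (i.val * (j + 1)) * G (j + 1)) n =
        (S2 k H ^ i.val) ∘ₗ convSeq k H (fun j => S2 k H ^ (i.val * j) * G (j + 1)) n := by
      apply toConv_injective
      have := sq_map (post ((S2_isBi (k := k) (H := H)).pow i.val).alg)
        (fun j => toConv (S2 k H ^ (i.val * j) * G (j + 1))) n
      rw [← toConv_convSeq] at this
      refine Eq.trans ?_ this.symm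
      rw [toConv_convSeq]
      congr 1
      funext j
      rw [Nat.mul_succ, add_comm, pow_add, mul_assoc]
      rfl
    simp only [convSeq, conv, LinearMap.comp_apply]
    rw [io_comul hsm, hpost, ← (ℛ k x).eq]
    simp only [map_sum, TensorProduct.map_tmul, LinearMap.mul'_apply, hFG, ih', io_mul hsm]
    refine Finset.sum_congr rfl fun l _ => ?_
    rw [succ_nsmul', mul_zero, pow_zero, one_mul]
    rfl

variable (SPinv : Module.End k P)
    (hSP1 : SPinv ∘ₗ HopfAlgebra.antipode (R := k) (A := P) = LinearMap.id)
include hSP1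

lemma Sinv_mul_S2 : (Sinv ∘ₗ Sinv) * S2 k H = 1 := by
  have := hsm.Sinv_left
  ext x
  have h1 : ∀ y, Sinv (antipode k y) = y := fun y => LinearMap.congr_fun this y
  simp [S2, h1]

lemma Sinv_eq : (Sinv ∘ₗ Sinv : Module.End k H) = S2 k H ^ (d - 1) := by
  have h1 := Sinv_mul_S2 hsm SPinv hSP1
  have h2 : S2 k H * S2 k H ^ (d - 1) = 1 := by
    rw [← pow_succ', Nat.sub_add_cancel hsm.d_pos, S2_pow_d hsm]
  exact left_inv_eq_right_inv h1 h2

lemma val_neg_pow (i : ZMod d) : S2 k H ^ (i.val + (-i).val) = 1 := by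
  have := hsm.d_pos
  haveI : NeZero d := ⟨this.ne'⟩
  have h : d ∣ i.val + (-i).val := by
    rw [← ZMod.natCast_eq_zero_iff]
    simp
  obtain ⟨c, hc⟩ := h
  rw [hc, pow_mul, S2_pow_d hsm, one_pow]

lemma SP_sq (i : ZMod d) (x : H) :
    antipode k (antipode k (io e i x)) = io e i (S2 k H x) := by
  have h := hsm.antipode_def
  rw [io_apply, h, h, neg_neg, io_apply]
  congr 2
  rw [Sinv_eq hsm SPinv hSP1]
  have hc : ∀ (m : ℕ) (y : H), (S2 k H ^ m) (antipode k y) = antipode k ((S2 k H ^ m) y) := by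
    intro m
    induction m with
    | zero => intro y; rfl
    | succ m ih =>
      intro y
      rw [pow_succ]
      change (S2 k H ^ m) (S2 k H (antipode k y)) = antipode k ((S2 k H ^ m) (S2 k H y))
      rw [← ih]
      rfl
  rw [← pow_mul, ← pow_mul, hc]
  change S2 k H ((S2 k H ^ ((d - 1) * (-i).val)) ((S2 k H ^ ((d - 1) * i.val)) x)) = _
  rw [← Module.End.mul_apply (S2 k H ^ ((d - 1) * (-i).val)), ← pow_add, ← mul_add, add_comm, mul_comm,
    pow_mul, val_neg_pow hsm SPinv hSP1, one_pow]
  rfl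

lemma SPinv_sq (i : ZMod d) (x : H) : (SPinv ∘ₗ SPinv) (io e i x) = io e i ((Sinv ∘ₗ Sinv) x) := by
  have h1 : ∀ y, SPinv (antipode k y) = y := fun y => LinearMap.congr_fun hSP1 y
  have hr : ∀ y, antipode k (Sinv y) = y := fun y => LinearMap.congr_fun hsm.Sinv_right y
  have h2 := SP_sq hsm SPinv hSP1 i ((Sinv ∘ₗ Sinv) x)
  have h3 : S2 k H ((Sinv ∘ₗ Sinv) x) = x := by simp [S2, hr]
  rw [h3] at h2
  rw [← h2]
  simp [h1]

lemma twist_P (n : ℕ) (i : ZMod d) (x : H) :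
    twistPow k P (SPinv ∘ₗ SPinv) n (io e i x) =
      io e (n • i) (twistPow k H (S2 k H ^ i.val * (Sinv ∘ₗ Sinv)) n x) := by
  have hF : ∀ (j : ℕ) (x : H), ((SPinv ∘ₗ SPinv) ^ j) (io e i x) =
      io e i (((Sinv ∘ₗ Sinv) ^ j : Module.End k H) x) := by
    intro j
    induction j with
    | zero => intro x; rfl
    | succ j ih =>
      intro x
      rw [pow_succ, pow_succ, Module.End.mul_apply, Module.End.mul_apply,
        SPinv_sq hsm SPinv hSP1, ih]
  rw [twistPow, io_seq hsm i n _ _ hF, twistPow]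
  congr 3
  funext j
  have hcomm : Commute (S2 k H ^ i.val) (Sinv ∘ₗ Sinv) := by
    rw [Sinv_eq hsm SPinv hSP1]
    exact Commute.pow_pow_self _ _ _
  rw [hcomm.mul_pow, pow_mul]

theorem P_iff [FiniteDimensional k H] (n : ℕ) :
    twistPow k P (SPinv ∘ₗ SPinv) n = convOne k P ↔
    sweedlerPow k H n = convOne k H ∧ twistPow k H (Sinv ∘ₗ Sinv) n = convOne k H := by
  have hd := hsm.d_pos
  haveI : NeZero d := ⟨hd.ne'⟩
  have hone : ∀ (i : ZMod d) (x : H), convOne k P (io e i x) = io e 0 (convOne k H x) := by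
    intro i x
    simp only [convOne, LinearMap.comp_apply, Algebra.linearMap_apply,
      Algebra.algebraMap_eq_smul_one, map_smul]
    rw [io_apply, hsm.counit_def, hsm.one_def, io_apply]
  have hl : ∀ y, Sinv (antipode k y) = y := fun y => LinearMap.congr_fun hsm.Sinv_left y
  have hr : ∀ y, antipode k (Sinv y) = y := fun y => LinearMap.congr_fun hsm.Sinv_right y
  have hSS : S2 k H * (Sinv ∘ₗ Sinv) = 1 := by
    ext x
    simp [S2, hr]
  constructor
  · intro h
    have hi : ∀ i : ZMod d,
        twistPow k H (S2 k H ^ i.val * (Sinv ∘ₗ Sinv)) n = convOne k H := by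
      intro i
      ext x
      have h1 := LinearMap.congr_fun h (io e i x)
      rw [twist_P hsm SPinv hSP1, hone] at h1
      exact io_inj h1
    constructor
    · have := hi 1
      have h1 : S2 k H ^ (1 : ZMod d).val = S2 k H := by
        rw [ZMod.val_one_eq_one_mod]
        conv_rhs => rw [← pow_one (S2 k H), ← Nat.mod_add_div 1 d, pow_add, pow_mul,
          S2_pow_d hsm, one_pow, mul_one]
      rw [h1, hSS, twist_iff] at this
      exact (sweedler_iff n).2 this
    · simpa using hi 0
  · rintro ⟨h0, h1⟩
    rw [sweedler_iff] at h0
    rw [twist_iff, Sinv_eq hsm SPinv hSP1] at h1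
    have hall := all_tw Sinv hl hr d hd (S2_pow_d hsm) n h0 h1
    have hpow : S2 k H ^ n = 1 := by
      have h3 := tw_pow (S2_isBi (k := k) (H := H)).alg n (by simpa using! hall 1)
      exact h3
    have hdn : d ∣ n := by
      rw [← hsm.order_eq]
      exact orderOf_dvd_of_pow_eq_one hpow
    apply io_ext (e := e)
    intro i x
    rw [twist_P hsm SPinv hSP1, hone]
    have h4 : n • i = 0 := by
      rw [nsmul_eq_mul, (ZMod.natCast_eq_zero_iff n d).2 hdn, zero_mul]
    have h5 : twistPow k H (S2 k H ^ i.val * (Sinv ∘ₗ Sinv)) n = convOne k H := by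
      rw [twist_iff, Sinv_eq hsm SPinv hSP1, ← pow_add]
      exact hall _
    rw [h4, h5]

end
end Rad

/-- for any finite-dimensional Hopf algebra `H`,
`exp(H ⋊ k⟨S²⟩) = lcm(exp₀(H), exp(H))`, stated via the divisibility characterization of
the lcm in `ℕ ∪ {∞}`.  Here `exp(K) = expAt k K (S_K⁻²)`. -/
theorem stmt14 (k H P : Type*) [Field k] [Ring H] [HopfAlgebra k H] [FiniteDimensional k H]
    [Ring P] [HopfAlgebra k P]
    (d : ℕ) (Sinv : Module.End k H) (e : P ≃ₗ[k] H ⊗[k] (ZMod d →₀ k))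
    (hsm : IsPivotalSmash k H P d Sinv e)
    (SPinv : Module.End k P)
    (hSP1 : SPinv ∘ₗ HopfAlgebra.antipode (R := k) (A := P) = LinearMap.id)
    (hSP2 : HopfAlgebra.antipode (R := k) (A := P) ∘ₗ SPinv = LinearMap.id) :
    exp0 k H ∣ expAt k P (SPinv ∘ₗ SPinv) ∧
    expAt k H (Sinv ∘ₗ Sinv) ∣ expAt k P (SPinv ∘ₗ SPinv) ∧
    ∀ m : ℕ∞, exp0 k H ∣ m → expAt k H (Sinv ∘ₗ Sinv) ∣ m →
      expAt k P (SPinv ∘ₗ SPinv) ∣ m := by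
  have hl : ∀ y, Sinv (HopfAlgebra.antipode k y) = y := fun y => LinearMap.congr_fun hsm.Sinv_left y
  have hr : ∀ y, HopfAlgebra.antipode k (Sinv y) = y :=
    fun y => LinearMap.congr_fun hsm.Sinv_right y
  let φ : H →ₐ[k] H := AlgHom.ofLinearMap (Sinv ∘ₗ Sinv)
    (by simp [Rad.T_one Sinv hl hr]) (fun x y => by simp [Rad.T_mul Sinv hl hr])
  refine Rad.ex_lcm (fun n => sweedlerPow k H n = convOne k H)
    (fun n => twistPow k H (Sinv ∘ₗ Sinv) n = convOne k H)
    (fun n => twistPow k P (SPinv ∘ₗ SPinv) n = convOne k P) ?_ ?_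
    (Rad.P_iff hsm SPinv hSP1)
  · intro m n h
    rw [Rad.sweedler_iff] at h
    rw [Rad.sweedler_iff, Rad.sweedler_iff]
    have := Rad.tw_add (AlgHom.id k H) m n h
    change Rad.tw (AlgHom.id k H).toLinearMap (m + n) = 1 ↔ Rad.tw (AlgHom.id k H).toLinearMap n = 1
    rw [this]
  · intro m n h
    rw [Rad.twist_iff] at h
    rw [Rad.twist_iff, Rad.twist_iff]
    have := Rad.tw_add φ m n h
    change Rad.tw φ.toLinearMap (m + n) = 1 ↔ Rad.tw φ.toLinearMap n = 1
    rw [this]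
end
end
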